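/- Let d ≥ 1, let O ⊆ ℝ^d be open, let D ⊆ ∂O, let p ∈ [1,∞) and s ∈ (0,1). Assume O satisfies the interior thickness condition in ∂O \ D with constant c > 0. Consider the ℝ-vector space V of (a.e.-equivalence classes of) measurable functions f : O → ℝ with ‖f‖^p := ‖f‖_{L^p(O)}^p + [f]_{W^{s,p}(O)}^p + ∫_O |f(x)|^p dist(x,D)^{-sp} dx < ∞. Then there exist a constant C > 0 and an ℝ-linear map E from V to (a.e.-equivalence classes of) measurable functions on ℝ^d such that for every f ∈ V one has (E f) = f almost everywhere on O and ‖E f‖_{L^p(ℝ^d)}^p + [E f]_{W^{s,p}(ℝ^d)}^p + ∫_{ℝ^d} |E f(x)|^p dist(x,D)^{-sp} dx ≤ C ‖f‖^p. -/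

import Mathlib

open MeasureTheory Metric ENNReal

/-- The `p`-th power of the `L^p` norm of `f` on `U`. -/
noncomputable def lpPow (d : ℕ) (p : ℝ) (U : Set (EuclideanSpace ℝ (Fin d)))
    (f : EuclideanSpace ℝ (Fin d) → ℝ) : ℝ≥0∞ :=
  ∫⁻ x in U, ENNReal.ofReal (|f x| ^ p)

/-- The `p`-th power of the fractional Sobolev seminorm `[f]_{W^{s,p}(U)}`. -/
noncomputable def gagliardoPow (d : ℕ) (s p : ℝ) (U : Set (EuclideanSpace ℝ (Fin d)))
    (f : EuclideanSpace ℝ (Fin d) → ℝ) : ℝ≥0∞ :=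
  ∫⁻ x in U, ∫⁻ y in U ∩ {y | dist x y < 1},
    ENNReal.ofReal (|f x - f y| ^ p / dist x y ^ (s * p + d))

/-- The fractional Hardy term `∫_U |f(x)|^p dist(x,D)^{-sp} dx`, with the convention
`0^{-sp} = ∞` (taken in `ℝ≥0∞`) so that the weight is infinite on `D`. -/
noncomputable def hardyPow (d : ℕ) (s p : ℝ) (U D : Set (EuclideanSpace ℝ (Fin d)))
    (f : EuclideanSpace ℝ (Fin d) → ℝ) : ℝ≥0∞ :=
  ∫⁻ x in U, ENNReal.ofReal (|f x| ^ p) * ENNReal.ofReal (Metric.infDist x D) ^ (-(s * p))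

/-- `‖f‖_{L^p(U)}^p + [f]_{W^{s,p}(U)}^p + ∫_U |f|^p dist(·,D)^{-sp}`. -/
noncomputable def sobPow (d : ℕ) (s p : ℝ) (U D : Set (EuclideanSpace ℝ (Fin d)))
    (f : EuclideanSpace ℝ (Fin d) → ℝ) : ℝ≥0∞ :=
  lpPow d p U f + gagliardoPow d s p U f + hardyPow d s p U D f

/-- `r ^ (-a)` as an extended nonnegative real, with `0 ^ (-a) = ∞` for `a > 0`. -/
noncomputable def ipow (a r : ℝ) : ℝ≥0∞ := ENNReal.ofReal r ^ (-a)

open Classical in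
/-- The `{0, 1}`-valued truth value of a proposition. -/
noncomputable def ind (P : Prop) : ℝ≥0∞ := if P then 1 else 0

lemma ind_of {P : Prop} (h : P) : ind P = 1 := if_pos h

lemma ind_of_not {P : Prop} (h : ¬ P) : ind P = 0 := if_neg h

lemma ind_le_one (P : Prop) : ind P ≤ 1 := by
  unfold ind; split_ifs <;> simp

lemma ind_mono {P Q : Prop} (h : P → Q) : ind P ≤ ind Q := by
  by_cases hP : P
  · rw [ind_of hP, ind_of (h hP)]
  · rw [ind_of_not hP]; exact zero_le

lemma measurable_ind {α : Type*} [MeasurableSpace α] {P : α → Prop}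
    (h : MeasurableSet {x | P x}) : Measurable fun x => ind (P x) :=
  Measurable.ite h measurable_const measurable_const

lemma lintegral_ind {α : Type*} [MeasurableSpace α] (μ : Measure α) {P : α → Prop}
    (h : MeasurableSet {x | P x}) : ∫⁻ x, ind (P x) ∂μ = μ {x | P x} := by
  rw [← lintegral_indicator_one h]
  refine lintegral_congr fun x => ?_
  by_cases hx : P x
  · rw [ind_of hx, Set.indicator_of_mem (by exact hx)]; rfl
  · rw [ind_of_not hx, Set.indicator_of_notMem (by exact hx)]

lemma measurable_ipow (a : ℝ) : Measurable (ipow a) := by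
  unfold ipow; fun_prop

lemma ipow_anti {a : ℝ} (ha : 0 ≤ a) {r t : ℝ} (h : r ≤ t) : ipow a t ≤ ipow a r := by
  unfold ipow
  rw [ENNReal.rpow_neg, ENNReal.rpow_neg]
  gcongr

lemma ipow_mul {a C r : ℝ} (hC : 0 < C) : ipow a (C * r) = ipow a C * ipow a r := by
  unfold ipow
  rw [ENNReal.ofReal_mul hC.le, ENNReal.mul_rpow_of_ne_top (by simp) (by simp)]

lemma ipow_ne_top {a r : ℝ} (hr : 0 < r) : ipow a r ≠ ⊤ := by
  unfold ipow
  exact ENNReal.rpow_ne_top_of_ne_zero (by simpa using hr) (by simp)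

/-- If `r ≤ C t` then `t ^ (-a) ≤ C ^ a r ^ (-a)`. -/
lemma ipow_le_of_le_mul {a C r t : ℝ} (ha : 0 ≤ a) (hC : 0 < C) (h : r ≤ C * t) :
    ipow a t ≤ ipow a C⁻¹ * ipow a r := by
  rw [← ipow_mul (inv_pos.2 hC)]
  apply ipow_anti ha
  rwa [inv_mul_le_iff₀ hC]

lemma ipow_zero_right {a : ℝ} (ha : 0 < a) : ipow a 0 = ⊤ := by
  simp [ipow, ENNReal.zero_rpow_of_neg, ha]

lemma ipow_eq_ofReal {a r : ℝ} (hr : 0 < r) : ipow a r = ENNReal.ofReal (r ^ (-a)) := by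
  unfold ipow; rw [ENNReal.ofReal_rpow_of_pos hr]

lemma ipow_add {a b r : ℝ} (hr : 0 < r) : ipow (a + b) r = ipow a r * ipow b r := by
  rw [ipow_eq_ofReal hr, ipow_eq_ofReal hr, ipow_eq_ofReal hr,
    ← ENNReal.ofReal_mul (by positivity), ← Real.rpow_add hr, neg_add]

lemma ipow_natCast {r : ℝ} (hr : 0 < r) (n : ℕ) : ipow n r = (ENNReal.ofReal (r ^ n))⁻¹ := by
  unfold ipow
  rw [ENNReal.rpow_neg, ENNReal.rpow_natCast, ENNReal.ofReal_pow hr.le]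

/-- Scaling of radial integrals. -/
lemma lintegral_radial_scale (d : ℕ) (b : ℝ) (φ : ℝ → ℝ≥0∞) (hφ : Measurable φ)
    (x : EuclideanSpace ℝ (Fin d)) {r : ℝ} (hr : 0 < r) :
    ∫⁻ y, φ (dist x y / r) * ipow (b + d) (dist x y) =
      ipow b r * ∫⁻ u : EuclideanSpace ℝ (Fin d), φ ‖u‖ * ipow (b + d) ‖u‖ := by
  set g : EuclideanSpace ℝ (Fin d) → ℝ≥0∞ := fun u => φ (‖u‖ / r) * ipow (b + d) ‖u‖ with hg
  have hgm : Measurable g := by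
    have := measurable_ipow (b + d)
    fun_prop
  have h1 : ∫⁻ y, φ (dist x y / r) * ipow (b + d) (dist x y) = ∫⁻ u, g u := by
    rw [← lintegral_sub_left_eq_self g x]
    simp only [hg, dist_eq_norm]
  have h2 : ∫⁻ u, g (r • u) = ENNReal.ofReal (r ^ d)⁻¹ * ∫⁻ u, g u := by
    rw [← lintegral_map hgm (measurable_const_smul r),
      Measure.map_addHaar_smul volume hr.ne', lintegral_smul_measure]
    simp [abs_of_pos hr]
  have h3 : ∫⁻ u, g u = ENNReal.ofReal (r ^ d) * ∫⁻ u, g (r • u) := by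
    rw [h2, ← mul_assoc, ← ENNReal.ofReal_mul (by positivity), mul_inv_cancel₀ (by positivity)]
    simp
  rw [h1, h3]
  have h4 : ∀ u : EuclideanSpace ℝ (Fin d), g (r • u) =
      ipow (b + d) r * (φ ‖u‖ * ipow (b + d) ‖u‖) := by
    intro u
    simp only [hg, norm_smul, Real.norm_eq_abs, abs_of_pos hr]
    rw [ipow_mul hr, mul_div_cancel_left₀ _ hr.ne']
    ring
  simp_rw [h4]
  rw [lintegral_const_mul', ← mul_assoc]
  · congr 1
    rw [ipow_add hr, ipow_natCast hr, mul_comm, mul_assoc, ENNReal.inv_mul_cancel]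
    · simp
    · simpa using by positivity
    · simp
  · exact ipow_ne_top hr

lemma exists_lintegral_tail_le (d : ℕ) {b : ℝ} (hb : 0 < b) :
    ∃ C : ℝ≥0∞, C ≠ ⊤ ∧ ∀ (x : EuclideanSpace ℝ (Fin d)) (r : ℝ), 0 ≤ r →
      ∫⁻ y, ind (r ≤ dist x y) * ipow (b + d) (dist x y) ≤ C * ipow b r := by
  have hmeas : Measurable fun t : ℝ => ind (1 ≤ t) := measurable_ind measurableSet_Ici
  set I := ∫⁻ u : EuclideanSpace ℝ (Fin d), ind (1 ≤ ‖u‖) * ipow (b + d) ‖u‖ with hI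
  have hIfin : I < ⊤ := by
    have h1 : ∀ u : EuclideanSpace ℝ (Fin d), ind (1 ≤ ‖u‖) * ipow (b + d) ‖u‖ ≤
        ipow (b + d) 2⁻¹ * ENNReal.ofReal ((1 + ‖u‖) ^ (-(b + d))) := by
      intro u
      by_cases hu : 1 ≤ ‖u‖
      · rw [ind_of hu, one_mul, ← ipow_eq_ofReal (by linarith)]
        exact ipow_le_of_le_mul (by positivity) two_pos (by linarith)
      · rw [ind_of_not hu, zero_mul]; exact zero_le
    refine lt_of_le_of_lt (lintegral_mono h1) ?_
    rw [lintegral_const_mul' _ _ (ipow_ne_top (by norm_num))]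
    exact ENNReal.mul_lt_top (ipow_ne_top (by norm_num)).lt_top
      (finite_integral_one_add_norm (by simpa using hb))
  refine ⟨I + 1, by simpa using hIfin.ne, fun x r hr => ?_⟩
  rcases hr.eq_or_lt with rfl | hr
  · rw [ipow_zero_right hb, ENNReal.mul_top (by simp)]; exact le_top
  have := lintegral_radial_scale d b _ hmeas x hr
  simp only [one_le_div hr] at this
  rw [this, mul_comm]
  gcongr
  exact le_self_add

lemma exists_lintegral_near_le (d : ℕ) (hd : 1 ≤ d) {b p : ℝ} (hb : b < p) :
    ∃ C : ℝ≥0∞, C ≠ ⊤ ∧ ∀ (x : EuclideanSpace ℝ (Fin d)) (r : ℝ), 0 < r →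
      ∫⁻ y, ind (dist x y < r) * ENNReal.ofReal (dist x y / r) ^ p * ipow (b + d) (dist x y)
        ≤ C * ipow b r := by
  have hmeas : Measurable fun t : ℝ => ind (t < 1) * ENNReal.ofReal t ^ p :=
    (measurable_ind measurableSet_Iio).mul (by fun_prop)
  refine ⟨∫⁻ u : EuclideanSpace ℝ (Fin d), ind (‖u‖ < 1) * ENNReal.ofReal ‖u‖ ^ p *
    ipow (b + d) ‖u‖, ?_, fun x r hr => ?_⟩
  · have : Nonempty (Fin d) := ⟨⟨0, hd⟩⟩
    have : Nontrivial (EuclideanSpace ℝ (Fin d)) := inferInstance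
    have hInt : IntegrableOn (fun u : EuclideanSpace ℝ (Fin d) => ‖u‖ ^ (-(b + d - p)))
        (ball 0 1) volume := by
      refine integrableOn_ball_of_norm_le_rpow (by simpa using hd) (C := 1) (α := b + d - p) ?_ ?_ ?_
      · simp; linarith
      · refine Filter.Eventually.of_forall fun u => ?_
        rw [one_mul, Real.norm_of_nonneg (by positivity)]
      · exact (measurable_norm.pow_const _).aestronglyMeasurable
    have h2 := hInt.2
    rw [hasFiniteIntegral_iff_enorm] at h2
    refine ne_top_of_le_ne_top h2.ne ?_
    rw [← lintegral_indicator measurableSet_ball]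
    refine lintegral_mono_ae ?_
    have h0 : ∀ᵐ u : EuclideanSpace ℝ (Fin d), u ≠ 0 := by
      simp [ae_iff]
    filter_upwards [h0] with u hu
    have hu' : 0 < ‖u‖ := norm_pos_iff.2 hu
    by_cases h1 : ‖u‖ < 1
    · rw [ind_of h1, Set.indicator_of_mem (by simpa using h1), one_mul,
        ENNReal.ofReal_rpow_of_pos hu', ipow_eq_ofReal hu', ← ENNReal.ofReal_mul (by positivity),
        ← Real.rpow_add hu', Real.enorm_of_nonneg (by positivity)]
      apply le_of_eq; congr 2; ring
    · simp [ind_of_not h1]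
  · have := lintegral_radial_scale d b _ hmeas x hr
    simp only [div_lt_one hr] at this
    rw [this, mul_comm]

/-- Jensen's inequality for a density of total mass at most `m`. -/
lemma lintegral_mul_rpow_le {α : Type*} [MeasurableSpace α] (μ : Measure α) {P g : α → ℝ≥0∞}
    (hP : Measurable P) (hg : Measurable g) {p : ℝ} (hp : 1 ≤ p) {m : ℝ≥0∞}
    (hm : ∫⁻ x, P x ∂μ ≤ m) :
    (∫⁻ x, P x * g x ∂μ) ^ p ≤ m ^ (p - 1) * ∫⁻ x, P x * g x ^ p ∂μ := by
  have hp0 : 0 < p := by linarith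
  have key := eLpNorm'_le_eLpNorm'_mul_rpow_measure_univ (μ := μ.withDensity P) (f := g)
    zero_lt_one hp hg.aestronglyMeasurable
  simp only [eLpNorm', enorm_eq_self, ENNReal.rpow_one, div_one, one_div] at key
  have h1 : ∫⁻ x, g x ∂μ.withDensity P = ∫⁻ x, P x * g x ∂μ := by
    rw [lintegral_withDensity_eq_lintegral_mul _ hP hg]; rfl
  have h2 : ∫⁻ x, g x ^ p ∂μ.withDensity P = ∫⁻ x, P x * g x ^ p ∂μ := by
    rw [lintegral_withDensity_eq_lintegral_mul _ hP (hg.pow_const p)]; rfl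
  rw [h1, h2, withDensity_apply _ MeasurableSet.univ, Measure.restrict_univ] at key
  calc (∫⁻ x, P x * g x ∂μ) ^ p
      ≤ ((∫⁻ x, P x * g x ^ p ∂μ) ^ p⁻¹ * (∫⁻ x, P x ∂μ) ^ (1 - p⁻¹)) ^ p := by
        gcongr
    _ = (∫⁻ x, P x * g x ^ p ∂μ) * (∫⁻ x, P x ∂μ) ^ (p - 1) := by
        rw [ENNReal.mul_rpow_of_nonneg _ _ hp0.le, ← ENNReal.rpow_mul, ← ENNReal.rpow_mul,
          inv_mul_cancel₀ hp0.ne', ENNReal.rpow_one, sub_mul, inv_mul_cancel₀ hp0.ne', one_mul]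
    _ ≤ m ^ (p - 1) * ∫⁻ x, P x * g x ^ p ∂μ := by
        rw [mul_comm]
        gcongr

/-- A set `O` together with a scale function `δ` (the distance to the part of the boundary where
`O` is thick) and a cutoff scale `R` (comparable to the truncated distance to the part of the
boundary where functions vanish). -/
structure WhitneyData (d : ℕ) (c : ℝ) where
  O : Set (EuclideanSpace ℝ (Fin d))
  δ : EuclideanSpace ℝ (Fin d) → ℝ
  R : EuclideanSpace ℝ (Fin d) → ℝ
  measO : MeasurableSet O
  δ_nonneg : ∀ x, 0 ≤ δ x
  δ_lip : ∀ x y, |δ x - δ y| ≤ dist x y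
  R_nonneg : ∀ x, 0 ≤ R x
  R_le : ∀ x, R x ≤ 1 / 64
  R_lip : ∀ x y, |R x - R y| ≤ 1 / 64 * dist x y
  thick : ∀ x, 0 < δ x → δ x < R x → ∃ x₀, dist x x₀ < 2 * δ x ∧
    ENNReal.ofReal c * volume (ball x₀ (δ x)) ≤ volume (ball x₀ (δ x) ∩ O)
  good : ∀ᵐ x, x ∉ O → 0 < δ x ∨ R x = 0
  sep : ∀ x y, x ∉ O → y ∈ O → min (δ x) (R x) ≤ dist x y

namespace WhitneyData

variable {d : ℕ} {c : ℝ} (W : WhitneyData d c)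

lemma continuous_δ : Continuous W.δ :=
  (LipschitzWith.of_dist_le_mul (K := 1) fun x y => by
    simpa [Real.dist_eq] using W.δ_lip x y).continuous

lemma continuous_R : Continuous W.R :=
  (LipschitzWith.of_dist_le_mul (K := 1) fun x y => by
    have := W.R_lip x y
    have h := dist_nonneg (x := x) (y := y)
    simp only [Real.dist_eq, NNReal.coe_one, one_mul]; linarith).continuous

/-- The multiplicity with which `z` is seen from points whose scale is less than `t`. -/
noncomputable def multiplicity (t : ℝ) (z : EuclideanSpace ℝ (Fin d)) : ℝ≥0∞ :=
  ∫⁻ x, ind (W.δ x < t ∧ dist x z < 4 * W.δ x) * ipow d (W.δ x)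

lemma measurableSet_visible :
    MeasurableSet {q : EuclideanSpace ℝ (Fin d) × EuclideanSpace ℝ (Fin d) |
      dist q.1 q.2 < 4 * W.δ q.1} := by
  have := W.continuous_δ
  exact measurableSet_lt (by fun_prop) (by fun_prop)

lemma measurable_multiplicity_integrand (t : ℝ) :
    Measurable fun q : EuclideanSpace ℝ (Fin d) × EuclideanSpace ℝ (Fin d) =>
      ind (W.δ q.1 < t ∧ dist q.1 q.2 < 4 * W.δ q.1) * ipow d (W.δ q.1) := by
  have h := W.continuous_δ.measurable
  refine (measurable_ind ?_).mul ((measurable_ipow _).comp (h.comp measurable_fst))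
  exact (measurableSet_lt (h.comp measurable_fst) measurable_const).inter W.measurableSet_visible

lemma measurable_multiplicity (t : ℝ) : Measurable (W.multiplicity t) :=
  (W.measurable_multiplicity_integrand t).lintegral_prod_left'

lemma volume_ball_eq (x : EuclideanSpace ℝ (Fin d)) {r : ℝ} (hr : 0 < r) :
    volume (ball x r) = ENNReal.ofReal (r ^ d) * volume (ball (0 : EuclideanSpace ℝ (Fin d)) 1) := by
  rw [Measure.addHaar_ball_of_pos volume x hr]; simp

lemma lintegral_ball_multiplicity_le (x₀ : EuclideanSpace ℝ (Fin d)) {r t : ℝ} (hr : 0 < r)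
    (ht : t ≤ 4 * r) :
    ∫⁻ z in ball x₀ r, W.multiplicity t z ≤
      ENNReal.ofReal (68 ^ d) * volume (ball (0 : EuclideanSpace ℝ (Fin d)) 1) *
        volume (ball x₀ r) := by
  set V := volume (ball (0 : EuclideanSpace ℝ (Fin d)) 1) with hV
  have hVtop : V ≠ ⊤ := measure_ball_lt_top.ne
  unfold multiplicity
  have hmeas : Measurable (Function.uncurry fun z x : EuclideanSpace ℝ (Fin d) =>
      ind (W.δ x < t ∧ dist x z < 4 * W.δ x) * ipow d (W.δ x)) :=
    (W.measurable_multiplicity_integrand t).comp measurable_swap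
  rw [lintegral_lintegral_swap hmeas.aemeasurable]
  have hb : ∀ x, ∫⁻ z in ball x₀ r, ind (W.δ x < t ∧ dist x z < 4 * W.δ x) * ipow d (W.δ x) ≤
      (ball x₀ (17 * r)).indicator (fun _ => ENNReal.ofReal (4 ^ d) * V) x := by
    intro x
    by_cases hx : 0 < W.δ x ∧ x ∈ ball x₀ (17 * r)
    · rw [Set.indicator_of_mem hx.2]
      calc ∫⁻ z in ball x₀ r, ind (W.δ x < t ∧ dist x z < 4 * W.δ x) * ipow d (W.δ x)
          ≤ ∫⁻ z, ind (z ∈ ball x (4 * W.δ x)) * ipow d (W.δ x) := by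
            refine (setLIntegral_le_lintegral _ _).trans (lintegral_mono fun z => ?_)
            gcongr
            refine ind_mono fun h => ?_
            rw [mem_ball']; exact h.2
        _ = volume (ball x (4 * W.δ x)) * ipow d (W.δ x) := by
            have hb : MeasurableSet {z | z ∈ ball x (4 * W.δ x)} := measurableSet_ball
            rw [lintegral_mul_const _ (measurable_ind hb), lintegral_ind _ hb]; rfl
        _ = ENNReal.ofReal (4 ^ d) * V := by
            have h := hx.1
            rw [volume_ball_eq x (by positivity), ipow_natCast h, mul_pow,
              ENNReal.ofReal_mul (by positivity), mul_right_comm, mul_assoc _ _ (_)⁻¹,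
              ENNReal.mul_inv_cancel (by simpa using by positivity) (by simp), mul_one]
        _ ≤ _ := le_rfl
    · rw [setLIntegral_congr_fun measurableSet_ball (g := fun _ => 0), lintegral_zero]
      · exact zero_le
      · intro z hz
        simp only
        rw [ind_of_not, zero_mul]
        rintro ⟨h1, h2⟩
        have h3 := dist_nonneg (x := x) (y := z)
        refine hx ⟨by linarith, ?_⟩
        rw [mem_ball] at hz ⊢
        linarith [dist_triangle x z x₀]
  refine (lintegral_mono hb).trans ?_
  rw [lintegral_indicator measurableSet_ball, setLIntegral_const, volume_ball_eq x₀ (by positivity),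
    volume_ball_eq x₀ hr, ← hV, mul_pow, show (68 : ℝ) = 4 * 17 by norm_num, mul_pow,
    ENNReal.ofReal_mul (by positivity), ENNReal.ofReal_mul (by positivity)]
  apply le_of_eq; ring

/-- The multiplicity threshold. -/
noncomputable def threshold (d : ℕ) (c : ℝ) : ℝ≥0∞ :=
  2 * ENNReal.ofReal (68 ^ d) * volume (ball (0 : EuclideanSpace ℝ (Fin d)) 1) / ENNReal.ofReal c

lemma threshold_ne_top (hc : 0 < c) : threshold d c ≠ ⊤ := by
  unfold threshold
  refine ENNReal.div_ne_top ?_ (by simpa using hc)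
  exact ENNReal.mul_ne_top (by finiteness) measure_ball_lt_top.ne

lemma threshold_pos : threshold d c ≠ 0 := by
  unfold threshold
  have : volume (ball (0 : EuclideanSpace ℝ (Fin d)) 1) ≠ 0 :=
    (measure_ball_pos _ _ one_pos).ne'
  rw [ENNReal.div_ne_zero]
  refine ⟨by simp [this], by simp⟩

/-- A thick ball contains many points of `O` of low multiplicity. -/
lemma volume_low_multiplicity_ge (hc : 0 < c) (x₀ : EuclideanSpace ℝ (Fin d)) {r t : ℝ}
    (hr : 0 < r) (ht : t ≤ 4 * r)
    (hthick : ENNReal.ofReal c * volume (ball x₀ r) ≤ volume (ball x₀ r ∩ W.O)) :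
    ENNReal.ofReal (c / 2) * volume (ball x₀ r) ≤
      volume (ball x₀ r ∩ W.O ∩ {z | W.multiplicity t z ≤ threshold d c}) := by
  set B := volume (ball x₀ r) with hB
  have hBtop : B ≠ ⊤ := measure_ball_lt_top.ne
  set Λ := threshold d c with hΛ
  have hmark : Λ * volume (ball x₀ r ∩ {z | Λ ≤ W.multiplicity t z}) ≤
      Λ * (ENNReal.ofReal (c / 2) * B) := by
    have h1 := mul_meas_ge_le_lintegral (μ := volume.restrict (ball x₀ r))
      (W.measurable_multiplicity t) Λ
    rw [Measure.restrict_apply (measurableSet_le measurable_const (W.measurable_multiplicity t)),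
      Set.inter_comm] at h1
    refine h1.trans ((W.lintegral_ball_multiplicity_le x₀ hr ht).trans (le_of_eq ?_))
    rw [hΛ, threshold, ← mul_assoc, ENNReal.ofReal_div_of_pos two_pos, ← hB]
    congr 1
    have hc' : ENNReal.ofReal c ≠ 0 := by simpa using hc
    simp only [div_eq_mul_inv, ENNReal.ofReal_ofNat]
    set a := ENNReal.ofReal c
    set V := volume (ball (0 : EuclideanSpace ℝ (Fin d)) 1)
    calc ENNReal.ofReal (68 ^ d) * V = (2 * 2⁻¹) * (a * a⁻¹) * (ENNReal.ofReal (68 ^ d) * V) := by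
          rw [ENNReal.mul_inv_cancel hc' (by simp [a]),
            ENNReal.mul_inv_cancel (by simp) (by simp), one_mul, one_mul]
      _ = _ := by ring
  have hmark' : volume (ball x₀ r ∩ {z | Λ ≤ W.multiplicity t z}) ≤
      ENNReal.ofReal (c / 2) * B :=
    (ENNReal.mul_le_mul_iff_right threshold_pos (threshold_ne_top hc)).1 hmark
  have hsplit : volume (ball x₀ r ∩ W.O) ≤
      volume (ball x₀ r ∩ W.O ∩ {z | W.multiplicity t z ≤ Λ}) + ENNReal.ofReal (c / 2) * B := by
    refine (measure_mono ?_).trans ((measure_union_le _ _).trans (add_le_add_right hmark' _))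
    intro z hz
    rcases le_total (W.multiplicity t z) Λ with h | h
    · exact Or.inl ⟨hz, h⟩
    · exact Or.inr ⟨hz.1, h⟩
  have h2 : ENNReal.ofReal c * B = ENNReal.ofReal (c / 2) * B + ENNReal.ofReal (c / 2) * B := by
    rw [← add_mul, ← ENNReal.ofReal_add (by positivity) (by positivity), add_halves]
  rw [h2] at hthick
  exact (ENNReal.add_le_add_iff_right (ENNReal.mul_ne_top (by simp) hBtop)).1
    (hthick.trans hsplit)

open Classical in
/-- The largest dyadic scale below which `z` has low multiplicity. -/
noncomputable def maxScale (z : EuclideanSpace ℝ (Fin d)) : ℝ :=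
  ⨆ j : ℕ, if W.multiplicity ((1 / 2) ^ j) z ≤ threshold d c then (1 / 2 : ℝ) ^ j else 0

lemma bddAbove_maxScale (z : EuclideanSpace ℝ (Fin d)) :
    BddAbove (Set.range fun j : ℕ =>
      open Classical in if W.multiplicity ((1 / 2) ^ j) z ≤ threshold d c
        then (1 / 2 : ℝ) ^ j else 0) := by
  refine ⟨1, ?_⟩
  rintro _ ⟨j, rfl⟩
  dsimp only
  split_ifs
  · exact pow_le_one₀ (by norm_num) (by norm_num)
  · exact zero_le_one

lemma measurable_maxScale : Measurable W.maxScale := by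
  classical
  unfold maxScale
  refine Measurable.iSup fun j => ?_
  exact Measurable.ite (measurableSet_le (W.measurable_multiplicity _) measurable_const)
    measurable_const measurable_const

lemma le_maxScale {z : EuclideanSpace ℝ (Fin d)} {j : ℕ}
    (h : W.multiplicity ((1 / 2) ^ j) z ≤ threshold d c) : (1 / 2 : ℝ) ^ j ≤ W.maxScale z := by
  classical
  refine le_trans ?_ (le_ciSup (W.bddAbove_maxScale z) j)
  simp only [if_pos h, le_refl]

lemma lintegral_lt_maxScale_le (z : EuclideanSpace ℝ (Fin d)) :
    ∫⁻ x, ind (W.δ x < W.maxScale z ∧ dist x z < 4 * W.δ x) * ipow d (W.δ x) ≤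
      threshold d c := by
  classical
  by_cases hex : ∃ j : ℕ, W.multiplicity ((1 / 2) ^ j) z ≤ threshold d c
  · have hle : W.maxScale z ≤ (1 / 2) ^ Nat.find hex := by
      refine ciSup_le fun j => ?_
      split_ifs with h
      · exact pow_le_pow_of_le_one (by norm_num) (by norm_num) (Nat.find_min' hex h)
      · positivity
    refine le_trans (lintegral_mono fun x => ?_) (Nat.find_spec hex)
    gcongr
    exact ind_mono fun h => ⟨h.1.trans_le hle, h.2⟩
  · have h0 : W.maxScale z = 0 := by
      unfold maxScale
      push Not at hex
      simp only [if_neg (not_le.2 (hex _)), ciSup_const]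
    refine le_trans (le_of_eq ?_) (zero_le (a := threshold d c))
    rw [← lintegral_zero (μ := (volume : Measure (EuclideanSpace ℝ (Fin d))))]
    refine lintegral_congr fun x => ?_
    rw [ind_of_not, zero_mul]
    rintro ⟨h1, _⟩
    linarith [W.δ_nonneg x]

/-- Near a point `x` with `δ x < R x` there are many points of `O` whose maximal scale is at
least `2 δ x`. -/
lemma volume_maxScale_ge (hc : 0 < c) {x : EuclideanSpace ℝ (Fin d)} (h0 : 0 < W.δ x)
    (hR : W.δ x < W.R x) :
    ENNReal.ofReal (c / 2) * volume (ball x (W.δ x)) ≤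
      volume ({z | dist x z < 3 * W.δ x ∧ 2 * W.δ x ≤ W.maxScale z} ∩ W.O) := by
  obtain ⟨x₀, hx₀, hth⟩ := W.thick x h0 hR
  have hR' := W.R_le x
  obtain ⟨n, hn1, hn2⟩ := exists_nat_pow_near_of_lt_one (x := 4 * W.δ x) (y := 1 / 2)
    (by positivity) (by linarith) (by norm_num) (by norm_num)
  have := W.volume_low_multiplicity_ge hc x₀ h0 hn1.le hth
  rw [volume_ball_eq x h0, ← volume_ball_eq x₀ h0]
  refine this.trans (measure_mono ?_)
  rintro z ⟨⟨hz1, hz2⟩, hz3⟩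
  refine ⟨⟨?_, ?_⟩, hz2⟩
  · rw [mem_ball] at hz1
    have := dist_triangle_right x z x₀
    linarith
  · refine le_trans ?_ (W.le_maxScale hz3)
    rw [pow_succ]; linarith

end WhitneyData

/-- A family of averaging kernels on `O` at the scale `δ x`, with bounded overlap. -/
structure ExtKernel {d : ℕ} {c : ℝ} (W : WhitneyData d c) (K : ℝ) where
  P : EuclideanSpace ℝ (Fin d) → EuclideanSpace ℝ (Fin d) → ℝ
  measurable : Measurable (Function.uncurry P)
  nonneg : ∀ x z, 0 ≤ P x z
  support : ∀ x z, P x z ≠ 0 → 0 < W.δ x ∧ W.δ x < W.R x ∧ dist x z < 4 * W.δ x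
  mass_le : ∀ x, ∫⁻ z in W.O, ENNReal.ofReal (P x z) ≤ 1
  mass_eq : ∀ x, 0 < W.δ x → 2 * W.δ x ≤ W.R x → ∫⁻ z in W.O, ENNReal.ofReal (P x z) = 1
  bound : ∀ x z, 0 < W.δ x → P x z ≤ K / W.δ x ^ d
  overlap : ∀ z, ∫⁻ x, ENNReal.ofReal (P x z) ≤ ENNReal.ofReal K
  lip : ∀ x x' z, 0 < W.δ x → dist x x' < W.δ x / 2 →
    |P x z - P x' z| ≤ K * (dist x x' / W.δ x) / W.δ x ^ d

section BumpIntegrals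

variable {d : ℕ}

lemma integrable_of_bounded_ball {g : EuclideanSpace ℝ (Fin d) → ℝ} (hg : Measurable g)
    {x : EuclideanSpace ℝ (Fin d)} {r M : ℝ} (hM : ∀ z, |g z| ≤ M)
    (h0 : ∀ z, z ∉ ball x r → g z = 0) (S : Set (EuclideanSpace ℝ (Fin d))) :
    Integrable g (volume.restrict S) ∧
      |∫ z in S, g z| ≤ M * volume.real (ball x r) := by
  have hM0 : 0 ≤ M := (abs_nonneg _).trans (hM x)
  have hb : ∀ z, ‖g z‖ ≤ (ball x r).indicator (fun _ => M) z := by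
    intro z
    by_cases hz : z ∈ ball x r
    · rw [Set.indicator_of_mem hz]; exact hM z
    · rw [Set.indicator_of_notMem hz, h0 z hz, norm_zero]
  have hi : Integrable ((ball x r).indicator fun _ => M) (volume : Measure (EuclideanSpace ℝ (Fin d))) :=
    (integrable_indicator_iff measurableSet_ball).2
      (integrableOn_const measure_ball_lt_top.ne)
  refine ⟨(hi.restrict (s := S)).mono' hg.aestronglyMeasurable (Filter.Eventually.of_forall hb), ?_⟩
  refine (norm_integral_le_of_norm_le (hi.restrict (s := S)) (Filter.Eventually.of_forall hb)).trans ?_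
  calc ∫ z in S, (ball x r).indicator (fun _ => M) z
      ≤ ∫ z, (ball x r).indicator (fun _ => M) z :=
        setIntegral_le_integral hi (Filter.Eventually.of_forall fun z =>
          Set.indicator_nonneg (fun _ _ => hM0) z)
    _ = M * volume.real (ball x r) := by
        rw [integral_indicator_const _ measurableSet_ball, smul_eq_mul, mul_comm]

lemma mul_measureReal_le_setIntegral {g : EuclideanSpace ℝ (Fin d) → ℝ} (hg : Measurable g)
    (hg0 : ∀ z, 0 ≤ g z) {S A : Set (EuclideanSpace ℝ (Fin d))}
    (hi : Integrable g (volume.restrict S)) {m v : ℝ} (hm : 0 < m) (hA : ∀ z ∈ A, m ≤ g z)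
    (hv : ENNReal.ofReal v ≤ volume (A ∩ S)) : m * v ≤ ∫ z in S, g z := by
  have h1 := mul_meas_ge_le_integral_of_nonneg (Filter.Eventually.of_forall hg0) hi m
  refine le_trans ?_ h1
  gcongr
  have hfin : volume.restrict S {z | m ≤ g z} ≠ ⊤ := (hi.measure_ge_lt_top hm).ne
  rw [Measure.real, ← ENNReal.ofReal_le_iff_le_toReal hfin]
  refine hv.trans ?_
  rw [Measure.restrict_apply (measurableSet_le measurable_const hg)]
  exact measure_mono (Set.inter_subset_inter_left _ fun z hz => hA z hz)

end BumpIntegrals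

namespace WhitneyData

variable {d : ℕ} {c : ℝ} (W : WhitneyData d c)

/-- The unnormalised averaging kernel on `O`. -/
noncomputable def bump (x z : EuclideanSpace ℝ (Fin d)) : ℝ :=
  max 0 (min (4 * W.δ x - dist x z) (min (W.maxScale z - W.δ x) (W.R x - W.δ x)))

/-- The kernel carrying the mass that is sent to the value zero. -/
noncomputable def nullBump (x z : EuclideanSpace ℝ (Fin d)) : ℝ :=
  max 0 (min (4 * W.δ x - dist x z) (2 * W.δ x - W.R x))

lemma bump_nonneg (x z : EuclideanSpace ℝ (Fin d)) : 0 ≤ W.bump x z := le_max_left _ _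

lemma nullBump_nonneg (x z : EuclideanSpace ℝ (Fin d)) : 0 ≤ W.nullBump x z := le_max_left _ _

lemma bump_le (x z : EuclideanSpace ℝ (Fin d)) : W.bump x z ≤ 4 * W.δ x := by
  have := W.δ_nonneg x
  refine max_le (by positivity) ((min_le_left _ _).trans ?_)
  linarith [dist_nonneg (x := x) (y := z)]

lemma nullBump_le (x z : EuclideanSpace ℝ (Fin d)) : W.nullBump x z ≤ 4 * W.δ x := by
  have := W.δ_nonneg x
  refine max_le (by positivity) ((min_le_left _ _).trans ?_)
  linarith [dist_nonneg (x := x) (y := z)]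

lemma bump_support {x z : EuclideanSpace ℝ (Fin d)} (h : W.bump x z ≠ 0) :
    dist x z < 4 * W.δ x ∧ W.δ x < W.maxScale z ∧ W.δ x < W.R x := by
  by_contra hn
  refine h (max_eq_left ?_)
  by_contra hlt
  push Not at hlt
  simp only [lt_min_iff] at hlt
  exact hn ⟨by linarith, by linarith, by linarith⟩

lemma nullBump_support {x z : EuclideanSpace ℝ (Fin d)} (h : W.nullBump x z ≠ 0) :
    dist x z < 4 * W.δ x ∧ W.R x < 2 * W.δ x := by
  by_contra hn
  refine h (max_eq_left ?_)
  by_contra hlt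
  push Not at hlt
  simp only [lt_min_iff] at hlt
  exact hn ⟨by linarith, by linarith⟩

lemma bump_eq_zero_of_notMem {x z : EuclideanSpace ℝ (Fin d)} (h : z ∉ ball x (4 * W.δ x)) :
    W.bump x z = 0 := by
  by_contra hn
  exact h (mem_ball'.2 (W.bump_support hn).1)

lemma nullBump_eq_zero_of_notMem {x z : EuclideanSpace ℝ (Fin d)} (h : z ∉ ball x (4 * W.δ x)) :
    W.nullBump x z = 0 := by
  by_contra hn
  exact h (mem_ball'.2 (W.nullBump_support hn).1)

lemma abs_bump_sub_le (x x' z : EuclideanSpace ℝ (Fin d)) :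
    |W.bump x z - W.bump x' z| ≤ 5 * dist x x' := by
  have h1 := abs_le.1 (W.δ_lip x x')
  have h2 := abs_le.1 (W.R_lip x x')
  have h3 := abs_le.1 (abs_dist_sub_le x x' z)
  have h0 := dist_nonneg (x := x) (y := x')
  refine (abs_max_sub_max_le_max _ _ _ _).trans (max_le (by simp) ?_)
  refine (abs_min_sub_min_le_max _ _ _ _).trans (max_le (abs_le.2 ⟨by linarith, by linarith⟩) ?_)
  refine (abs_min_sub_min_le_max _ _ _ _).trans (max_le ?_ ?_) <;>
  exact abs_le.2 ⟨by linarith, by linarith⟩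

lemma abs_nullBump_sub_le (x x' z : EuclideanSpace ℝ (Fin d)) :
    |W.nullBump x z - W.nullBump x' z| ≤ 5 * dist x x' := by
  have h1 := abs_le.1 (W.δ_lip x x')
  have h2 := abs_le.1 (W.R_lip x x')
  have h3 := abs_le.1 (abs_dist_sub_le x x' z)
  have h0 := dist_nonneg (x := x) (y := x')
  refine (abs_max_sub_max_le_max _ _ _ _).trans (max_le (by simp) ?_)
  refine (abs_min_sub_min_le_max _ _ _ _).trans (max_le ?_ ?_) <;>
  exact abs_le.2 ⟨by linarith, by linarith⟩

lemma measurable_bump : Measurable (Function.uncurry W.bump) := by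
  have h1 := W.continuous_δ.measurable
  have h2 := W.continuous_R.measurable
  have h3 := W.measurable_maxScale
  unfold bump Function.uncurry
  fun_prop

lemma measurable_nullBump : Measurable (Function.uncurry W.nullBump) := by
  have h1 := W.continuous_δ.measurable
  have h2 := W.continuous_R.measurable
  unfold nullBump Function.uncurry
  fun_prop

/-- The total mass of the kernels. -/
noncomputable def totalMass (x : EuclideanSpace ℝ (Fin d)) : ℝ :=
  (∫ z in W.O, W.bump x z) + ∫ z in Set.univ, W.nullBump x z

lemma measurable_totalMass : Measurable W.totalMass :=
  (W.measurable_bump.stronglyMeasurable.integral_prod_right).measurable.add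
    (W.measurable_nullBump.stronglyMeasurable.integral_prod_right).measurable

lemma integrable_bump (x : EuclideanSpace ℝ (Fin d)) (S : Set (EuclideanSpace ℝ (Fin d))) :
    Integrable (W.bump x) (volume.restrict S) :=
  (integrable_of_bounded_ball (W.measurable_bump.of_uncurry_left (x := x))
    (fun z => (abs_of_nonneg (W.bump_nonneg x z)).trans_le (W.bump_le x z))
    (fun _ h => W.bump_eq_zero_of_notMem h) S).1

lemma integrable_nullBump (x : EuclideanSpace ℝ (Fin d)) (S : Set (EuclideanSpace ℝ (Fin d))) :
    Integrable (W.nullBump x) (volume.restrict S) :=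
  (integrable_of_bounded_ball (W.measurable_nullBump.of_uncurry_left (x := x))
    (fun z => (abs_of_nonneg (W.nullBump_nonneg x z)).trans_le (W.nullBump_le x z))
    (fun _ h => W.nullBump_eq_zero_of_notMem h) S).1

/-- The volume of the unit ball. -/
noncomputable def unitVol (d : ℕ) : ℝ := volume.real (ball (0 : EuclideanSpace ℝ (Fin d)) 1)

lemma unitVol_pos : 0 < unitVol d :=
  ENNReal.toReal_pos (measure_ball_pos _ _ one_pos).ne' measure_ball_lt_top.ne

lemma volume_ball_eq_ofReal (x : EuclideanSpace ℝ (Fin d)) {r : ℝ} (hr : 0 < r) :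
    volume (ball x r) = ENNReal.ofReal (r ^ d * unitVol d) := by
  rw [volume_ball_eq x hr, ENNReal.ofReal_mul (by positivity), unitVol, ofReal_measureReal]

lemma volumeReal_ball_eq (x : EuclideanSpace ℝ (Fin d)) {r : ℝ} (hr : 0 < r) :
    volume.real (ball x r) = r ^ d * unitVol d := by
  have := unitVol_pos (d := d)
  rw [Measure.real, volume_ball_eq_ofReal x hr, ENNReal.toReal_ofReal (by positivity)]

/-- A lower bound for the normalised total mass. -/
noncomputable def massConst (d : ℕ) (c : ℝ) : ℝ := min (c / 8) (1 / 2) * unitVol d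

lemma massConst_pos (hc : 0 < c) : 0 < massConst d c :=
  mul_pos (lt_min (by positivity) (by norm_num)) unitVol_pos

lemma totalMass_ge (hc : 0 < c) {x : EuclideanSpace ℝ (Fin d)} (h0 : 0 < W.δ x) :
    massConst d c * W.δ x ^ (d + 1) ≤ W.totalMass x := by
  have hV := unitVol_pos (d := d)
  have hI1 : 0 ≤ ∫ z in W.O, W.bump x z := integral_nonneg fun z => W.bump_nonneg x z
  have hI2 : 0 ≤ ∫ z in Set.univ, W.nullBump x z := integral_nonneg fun z => W.nullBump_nonneg x z
  rcases le_or_gt (5 * W.δ x) (4 * W.R x) with h | h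
  · have hlow := mul_measureReal_le_setIntegral (W.measurable_bump.of_uncurry_left (x := x))
      (W.bump_nonneg x) (S := W.O) (A := {z | dist x z < 3 * W.δ x ∧ 2 * W.δ x ≤ W.maxScale z})
      (W.integrable_bump x _) (m := W.δ x / 4) (v := c / 2 * (W.δ x ^ d * unitVol d))
      (by positivity) ?_ ?_
    · refine le_trans ?_ (hlow.trans (le_add_of_nonneg_right hI2))
      calc massConst d c * W.δ x ^ (d + 1) ≤ c / 8 * unitVol d * W.δ x ^ (d + 1) := by
            unfold massConst; gcongr; exact min_le_left _ _
        _ = _ := by ring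
    · rintro z ⟨hz1, hz2⟩
      exact le_max_of_le_right (le_min (by linarith) (le_min (by linarith) (by linarith)))
    · have := W.volume_maxScale_ge hc h0 (by linarith)
      rwa [volume_ball_eq_ofReal x h0, ← ENNReal.ofReal_mul (by positivity)] at this
  · have hlow := mul_measureReal_le_setIntegral (W.measurable_nullBump.of_uncurry_left (x := x))
      (W.nullBump_nonneg x) (S := Set.univ) (A := ball x (W.δ x))
      (W.integrable_nullBump x _) (m := W.δ x / 2) (v := W.δ x ^ d * unitVol d)
      (by positivity) ?_ ?_
    · refine le_trans ?_ (hlow.trans (le_add_of_nonneg_left hI1))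
      calc massConst d c * W.δ x ^ (d + 1) ≤ 1 / 2 * unitVol d * W.δ x ^ (d + 1) := by
            unfold massConst; gcongr; exact min_le_right _ _
        _ = _ := by ring
    · intro z hz
      rw [mem_ball'] at hz
      exact le_max_of_le_right (le_min (by linarith) (by linarith))
    · rw [Set.inter_univ, volume_ball_eq_ofReal x h0]

lemma abs_totalMass_sub_le {x x' : EuclideanSpace ℝ (Fin d)} (h0 : 0 < W.δ x)
    (h : dist x x' < W.δ x / 2) :
    |W.totalMass x - W.totalMass x'| ≤
      10 * dist x x' * ((8 * W.δ x) ^ d * unitVol d) := by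
  have hδ := abs_le.1 (W.δ_lip x x')
  have hball : ∀ z, z ∉ ball x (8 * W.δ x) → z ∉ ball x (4 * W.δ x) ∧ z ∉ ball x' (4 * W.δ x') := by
    intro z hz
    refine ⟨fun hz' => hz (ball_subset_ball (by linarith) hz'), fun hz' => hz ?_⟩
    rw [mem_ball'] at hz' ⊢
    linarith [dist_triangle x x' z]
  have h1 := (integrable_of_bounded_ball
    ((W.measurable_bump.of_uncurry_left (x := x)).sub (W.measurable_bump.of_uncurry_left (x := x')))
    (M := 5 * dist x x') (x := x) (r := 8 * W.δ x) (W.abs_bump_sub_le x x')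
    (fun z hz => by
      simp [W.bump_eq_zero_of_notMem (hball z hz).1, W.bump_eq_zero_of_notMem (hball z hz).2])
    W.O).2
  have h2 := (integrable_of_bounded_ball
    ((W.measurable_nullBump.of_uncurry_left (x := x)).sub
      (W.measurable_nullBump.of_uncurry_left (x := x')))
    (M := 5 * dist x x') (x := x) (r := 8 * W.δ x) (W.abs_nullBump_sub_le x x')
    (fun z hz => by
      simp [W.nullBump_eq_zero_of_notMem (hball z hz).1,
        W.nullBump_eq_zero_of_notMem (hball z hz).2])
    Set.univ).2
  simp only [Pi.sub_apply] at h1 h2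
  rw [integral_sub (W.integrable_bump x _) (W.integrable_bump x' _),
    volumeReal_ball_eq x (by positivity)] at h1
  rw [integral_sub (W.integrable_nullBump x _) (W.integrable_nullBump x' _),
    volumeReal_ball_eq x (by positivity)] at h2
  unfold totalMass
  rw [abs_le] at *
  constructor <;> linarith [h1.1, h1.2, h2.1, h2.2]

lemma bump_div_totalMass_le (hc : 0 < c) {x : EuclideanSpace ℝ (Fin d)} (h0 : 0 < W.δ x)
    (z : EuclideanSpace ℝ (Fin d)) :
    W.bump x z / W.totalMass x ≤ 4 / massConst d c / W.δ x ^ d := by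
  have hm := massConst_pos (d := d) hc
  have hQ := W.totalMass_ge hc h0
  have hQ0 : 0 < massConst d c * W.δ x ^ (d + 1) := by positivity
  rw [div_le_iff₀ (hQ0.trans_le hQ)]
  calc W.bump x z ≤ 4 * W.δ x := W.bump_le x z
    _ = 4 / massConst d c / W.δ x ^ d * (massConst d c * W.δ x ^ (d + 1)) := by
        field_simp; ring
    _ ≤ _ := by gcongr

/-- The constant of the extension kernel. -/
noncomputable def kernelConst (d : ℕ) (c : ℝ) : ℝ :=
  5 / massConst d c + 40 * 16 ^ d * unitVol d / massConst d c ^ 2 +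
    4 / massConst d c * (threshold d c).toReal

lemma le_kernelConst (hc : 0 < c) : 4 / massConst d c ≤ kernelConst d c := by
  have hm := massConst_pos (d := d) hc
  have hV := unitVol_pos (d := d)
  have h1 : 0 ≤ 40 * 16 ^ d * unitVol d / massConst d c ^ 2 := by positivity
  have h2 : 0 ≤ 4 / massConst d c * (threshold d c).toReal := by positivity
  have h3 : 4 / massConst d c ≤ 5 / massConst d c := by gcongr; norm_num
  unfold kernelConst
  linarith

lemma kernel_lip (hc : 0 < c) {x x' : EuclideanSpace ℝ (Fin d)} (h0 : 0 < W.δ x)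
    (hlt : dist x x' < W.δ x / 2) (z : EuclideanSpace ℝ (Fin d)) :
    |W.bump x z / W.totalMass x - W.bump x' z / W.totalMass x'| ≤
      kernelConst d c * (dist x x' / W.δ x) / W.δ x ^ d := by
  have hδ := abs_le.1 (W.δ_lip x x')
  have h0' : 0 < W.δ x' := by linarith
  have hm := massConst_pos (d := d) hc
  have hV := unitVol_pos (d := d)
  set m := massConst d c
  set V := unitVol d
  set δ := W.δ x
  set h := dist x x'
  have hh : 0 ≤ h := dist_nonneg
  have hQ : m * δ ^ (d + 1) ≤ W.totalMass x := W.totalMass_ge hc h0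
  have hQ' : m * W.δ x' ^ (d + 1) ≤ W.totalMass x' := W.totalMass_ge hc h0'
  have hQp : 0 < W.totalMass x := lt_of_lt_of_le (by positivity) hQ
  have hQp' : 0 < W.totalMass x' := lt_of_lt_of_le (by positivity) hQ'
  have hP' : W.bump x' z / W.totalMass x' ≤ 4 / m * 2 ^ d / δ ^ d := by
    refine (W.bump_div_totalMass_le hc h0' z).trans ?_
    have : (δ / 2) ^ d ≤ W.δ x' ^ d := by gcongr; linarith
    calc 4 / m / W.δ x' ^ d ≤ 4 / m / (δ / 2) ^ d := by gcongr
      _ = _ := by rw [div_pow]; field_simp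
  have hP0 : 0 ≤ W.bump x' z / W.totalMass x' := div_nonneg (W.bump_nonneg _ _) hQp'.le
  have hdec : W.bump x z / W.totalMass x - W.bump x' z / W.totalMass x' =
      (W.bump x z - W.bump x' z) / W.totalMass x +
      (W.bump x' z / W.totalMass x') * ((W.totalMass x' - W.totalMass x) / W.totalMass x) := by
    field_simp; ring
  rw [hdec]
  have e1 : |(W.bump x z - W.bump x' z) / W.totalMass x| ≤ 5 / m * (h / δ) / δ ^ d := by
    rw [abs_div, abs_of_pos hQp]
    calc |W.bump x z - W.bump x' z| / W.totalMass x ≤ 5 * h / (m * δ ^ (d + 1)) := by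
          gcongr; exact W.abs_bump_sub_le x x' z
      _ = _ := by field_simp; ring
  have e2 : |(W.bump x' z / W.totalMass x') * ((W.totalMass x' - W.totalMass x) / W.totalMass x)|
      ≤ 40 * 16 ^ d * V / m ^ 2 * (h / δ) / δ ^ d := by
    rw [abs_mul, abs_of_nonneg hP0, abs_div, abs_of_pos hQp, abs_sub_comm]
    calc (W.bump x' z / W.totalMass x') * (|W.totalMass x - W.totalMass x'| / W.totalMass x)
        ≤ (4 / m * 2 ^ d / δ ^ d) * (10 * h * ((8 * δ) ^ d * V) / (m * δ ^ (d + 1))) := by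
          gcongr; exact W.abs_totalMass_sub_le h0 hlt
      _ = _ := by
          rw [show (16 : ℝ) = 2 * 8 by norm_num, mul_pow, mul_pow]
          field_simp; ring
  refine (abs_add_le _ _).trans ((add_le_add e1 e2).trans ?_)
  have h3 : 0 ≤ 4 / m * (threshold d c).toReal * (h / δ) / δ ^ d := by positivity
  unfold kernelConst
  rw [add_mul, add_mul, add_div, add_div]
  linarith

/-- The normalised kernel. -/
noncomputable def extKernel (hc : 0 < c) : ExtKernel W (kernelConst d c) where
  P x z := W.bump x z / W.totalMass x
  measurable := W.measurable_bump.div (W.measurable_totalMass.comp measurable_fst)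
  nonneg x z := by
    refine div_nonneg (W.bump_nonneg x z) (add_nonneg ?_ ?_)
    · exact integral_nonneg fun z => W.bump_nonneg x z
    · exact integral_nonneg fun z => W.nullBump_nonneg x z
  support x z h := by
    have hb : W.bump x z ≠ 0 := fun h0 => h (by rw [h0, zero_div])
    obtain ⟨h1, _, h3⟩ := W.bump_support hb
    exact ⟨by linarith [dist_nonneg (x := x) (y := z)], h3, h1⟩
  mass_le x := by
    rw [← ofReal_integral_eq_lintegral_ofReal ((W.integrable_bump x _).div_const _)
      (Filter.Eventually.of_forall fun z => ?_), integral_div]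
    · rw [← ENNReal.ofReal_one]
      have hI : 0 ≤ ∫ z in W.O, W.bump x z := integral_nonneg fun z => W.bump_nonneg x z
      have hJ : 0 ≤ ∫ z in Set.univ, W.nullBump x z := integral_nonneg fun z => W.nullBump_nonneg x z
      refine ENNReal.ofReal_le_ofReal (div_le_one_of_le₀ ?_ (add_nonneg hI hJ))
      exact le_add_of_nonneg_right hJ
    · refine div_nonneg (W.bump_nonneg x z) (add_nonneg ?_ ?_)
      · exact integral_nonneg fun z => W.bump_nonneg x z
      · exact integral_nonneg fun z => W.nullBump_nonneg x z
  mass_eq x h0 hR := by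
    have hm := massConst_pos (d := d) hc
    have hQ : 0 < W.totalMass x := lt_of_lt_of_le (by positivity) (W.totalMass_ge hc h0)
    have hJ : ∫ z in Set.univ, W.nullBump x z = 0 := by
      rw [← integral_zero (EuclideanSpace ℝ (Fin d)) ℝ (μ := volume.restrict Set.univ)]
      congr 1
      ext z
      by_contra hn
      linarith [(W.nullBump_support hn).2]
    rw [← ofReal_integral_eq_lintegral_ofReal ((W.integrable_bump x _).div_const _)
      (Filter.Eventually.of_forall fun z => div_nonneg (W.bump_nonneg x z) hQ.le), integral_div]
    have : ∫ z in W.O, W.bump x z = W.totalMass x := by rw [totalMass, hJ, add_zero]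
    rw [this, div_self hQ.ne', ENNReal.ofReal_one]
  bound x z h0 := (W.bump_div_totalMass_le hc h0 z).trans (by
    gcongr; exact le_kernelConst hc)
  overlap z := by
    have hm := massConst_pos (d := d) hc
    have hV := unitVol_pos (d := d)
    calc ∫⁻ x, ENNReal.ofReal (W.bump x z / W.totalMass x)
        ≤ ∫⁻ x, ENNReal.ofReal (4 / massConst d c) *
            (ind (W.δ x < W.maxScale z ∧ dist x z < 4 * W.δ x) * ipow d (W.δ x)) := by
          refine lintegral_mono fun x => ?_
          by_cases hb : W.bump x z = 0
          · simp [hb]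
          obtain ⟨h1, h2, h3⟩ := W.bump_support hb
          have h0 : 0 < W.δ x := by linarith [dist_nonneg (x := x) (y := z)]
          rw [ind_of ⟨h2, h1⟩, one_mul, ipow_eq_ofReal h0, ← ENNReal.ofReal_mul (by positivity)]
          refine ENNReal.ofReal_le_ofReal ((W.bump_div_totalMass_le hc h0 z).trans_eq ?_)
          rw [Real.rpow_neg h0.le, Real.rpow_natCast, div_eq_mul_inv]
      _ ≤ ENNReal.ofReal (4 / massConst d c) * threshold d c := by
          rw [lintegral_const_mul' _ _ (by simp)]
          gcongr
          exact W.lintegral_lt_maxScale_le z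
      _ = ENNReal.ofReal (4 / massConst d c * (threshold d c).toReal) := by
          rw [ENNReal.ofReal_mul (by positivity), ENNReal.ofReal_toReal (threshold_ne_top hc)]
      _ ≤ _ := by
          refine ENNReal.ofReal_le_ofReal ?_
          have h1 : 0 ≤ 40 * 16 ^ d * unitVol d / massConst d c ^ 2 := by positivity
          have h2 : 0 ≤ 5 / massConst d c := by positivity
          unfold kernelConst
          linarith
  lip x x' z h0 h := W.kernel_lip hc h0 h z

end WhitneyData

lemma setLIntegral_eq_lintegral_ind_mul {α : Type*} [MeasurableSpace α] {μ : Measure α}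
    {S : Set α} (hS : MeasurableSet S) (g : α → ℝ≥0∞) :
    ∫⁻ z in S, g z ∂μ = ∫⁻ z, ind (z ∈ S) * g z ∂μ := by
  rw [← lintegral_indicator hS]
  refine lintegral_congr fun z => ?_
  by_cases hz : z ∈ S
  · rw [Set.indicator_of_mem hz, ind_of hz, one_mul]
  · rw [Set.indicator_of_notMem hz, ind_of_not hz, zero_mul]

namespace ExtKernel

variable {d : ℕ} {c K : ℝ} {W : WhitneyData d c} (κ : ExtKernel W K)

/-- The averaging kernel restricted to `O`, with values in `ℝ≥0∞`. -/
noncomputable def Q (x z : EuclideanSpace ℝ (Fin d)) : ℝ≥0∞ :=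
  ind (z ∈ W.O) * ENNReal.ofReal (κ.P x z)

lemma measurable_Q : Measurable (Function.uncurry κ.Q) :=
  (measurable_ind (measurable_snd W.measO)).mul κ.measurable.ennreal_ofReal

lemma Q_support {x z : EuclideanSpace ℝ (Fin d)} (h : κ.Q x z ≠ 0) :
    z ∈ W.O ∧ 0 < W.δ x ∧ W.δ x < W.R x ∧ dist x z < 4 * W.δ x := by
  have hz : z ∈ W.O := by
    by_contra hn
    exact h (by rw [Q, ind_of_not hn, zero_mul])
  refine ⟨hz, κ.support x z fun h0 => h ?_⟩
  rw [Q, h0, ENNReal.ofReal_zero, mul_zero]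

lemma lintegral_Q_mul (x : EuclideanSpace ℝ (Fin d)) (g : EuclideanSpace ℝ (Fin d) → ℝ≥0∞) :
    ∫⁻ z, κ.Q x z * g z = ∫⁻ z in W.O, ENNReal.ofReal (κ.P x z) * g z := by
  rw [setLIntegral_eq_lintegral_ind_mul W.measO]
  simp only [Q, mul_assoc]

lemma lintegral_Q_le (x : EuclideanSpace ℝ (Fin d)) : ∫⁻ z, κ.Q x z ≤ 1 := by
  have := κ.lintegral_Q_mul x fun _ => 1
  simp only [mul_one] at this
  exact this ▸ κ.mass_le x

lemma lintegral_Q_left_le (z : EuclideanSpace ℝ (Fin d)) :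
    ∫⁻ x, κ.Q x z ≤ ENNReal.ofReal K := by
  refine le_trans (lintegral_mono fun x => ?_) (κ.overlap z)
  exact mul_le_of_le_one_left' (ind_le_one _)

lemma measurable_Q_right (x : EuclideanSpace ℝ (Fin d)) : Measurable (κ.Q x) :=
  κ.measurable_Q.of_uncurry_left (x := x)

lemma measurable_P_right (x : EuclideanSpace ℝ (Fin d)) : Measurable (κ.P x) :=
  κ.measurable.of_uncurry_left (x := x)

/-- The averages of `f` against the kernel. -/
noncomputable def avg (f : EuclideanSpace ℝ (Fin d) → ℝ) (x : EuclideanSpace ℝ (Fin d)) : ℝ :=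
  ∫ z in W.O, κ.P x z * f z

lemma measurable_avg {f : EuclideanSpace ℝ (Fin d) → ℝ} (hf : Measurable f) :
    Measurable (κ.avg f) := by
  have : Measurable fun q : EuclideanSpace ℝ (Fin d) × EuclideanSpace ℝ (Fin d) =>
      κ.P q.1 q.2 * f q.2 := κ.measurable.mul (hf.comp measurable_snd)
  exact (this.stronglyMeasurable.integral_prod_right).measurable

section

variable {p : ℝ} (hp : 1 ≤ p) {f : EuclideanSpace ℝ (Fin d) → ℝ} (hf : Measurable f)
  (hfin : ∫⁻ z in W.O, ‖f z‖ₑ ^ p < ⊤)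

include hp hf in
lemma lintegral_Q_rpow_le (x : EuclideanSpace ℝ (Fin d)) (b : ℝ) :
    (∫⁻ z, κ.Q x z * ‖f z - b‖ₑ) ^ p ≤ ∫⁻ z, κ.Q x z * ‖f z - b‖ₑ ^ p := by
  have hm : Measurable fun z => ‖f z - b‖ₑ := (hf.sub_const b).enorm
  simpa using lintegral_mul_rpow_le volume (κ.measurable_Q_right x) hm hp (κ.lintegral_Q_le x)

lemma Q_le (x z : EuclideanSpace ℝ (Fin d)) :
    κ.Q x z ≤ ENNReal.ofReal (K / W.δ x ^ d) * ind (z ∈ W.O) := by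
  by_cases h : κ.Q x z = 0
  · rw [h]; exact zero_le
  · obtain ⟨hz, h0, -⟩ := κ.Q_support h
    rw [ind_of hz, mul_one]
    exact (mul_le_of_le_one_left' (ind_le_one _)).trans
      (ENNReal.ofReal_le_ofReal (κ.bound x z h0))

include hp hf hfin in
lemma integrable_mul (x : EuclideanSpace ℝ (Fin d)) :
    Integrable (fun z => κ.P x z * f z) (volume.restrict W.O) := by
  refine ⟨((κ.measurable_P_right x).mul hf).aestronglyMeasurable, ?_⟩
  have hp0 : 0 < p := by linarith
  have h1 : ∫⁻ z in W.O, ‖κ.P x z * f z‖ₑ = ∫⁻ z, κ.Q x z * ‖f z - 0‖ₑ := by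
    rw [lintegral_Q_mul]
    refine lintegral_congr fun z => ?_
    rw [enorm_mul, Real.enorm_eq_ofReal (κ.nonneg x z), sub_zero]
  rw [HasFiniteIntegral, h1]
  rw [← ENNReal.rpow_lt_top_iff_of_pos hp0]
  refine (κ.lintegral_Q_rpow_le hp hf x 0).trans_lt ?_
  calc ∫⁻ z, κ.Q x z * ‖f z - 0‖ₑ ^ p
      ≤ ∫⁻ z, ENNReal.ofReal (K / W.δ x ^ d) * (ind (z ∈ W.O) * ‖f z‖ₑ ^ p) := by
        refine lintegral_mono fun z => ?_
        rw [sub_zero, ← mul_assoc]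
        gcongr
        exact κ.Q_le x z
    _ = ENNReal.ofReal (K / W.δ x ^ d) * ∫⁻ z in W.O, ‖f z‖ₑ ^ p := by
        rw [lintegral_const_mul' _ _ (by simp), setLIntegral_eq_lintegral_ind_mul W.measO]
    _ < ⊤ := ENNReal.mul_lt_top (by simp) hfin

lemma integrable_P (x : EuclideanSpace ℝ (Fin d)) :
    Integrable (κ.P x) (volume.restrict W.O) := by
  refine ⟨(κ.measurable_P_right x).aestronglyMeasurable, ?_⟩
  refine lt_of_le_of_lt ?_ ((κ.mass_le x).trans_lt ENNReal.one_lt_top)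
  exact lintegral_mono fun z => (Real.enorm_eq_ofReal (κ.nonneg x z)).le

lemma integral_P_eq (x : EuclideanSpace ℝ (Fin d)) :
    ∫ z in W.O, κ.P x z = (∫⁻ z in W.O, ENNReal.ofReal (κ.P x z)).toReal :=
  integral_eq_lintegral_of_nonneg_ae (Filter.Eventually.of_forall fun z => κ.nonneg x z)
    (κ.measurable_P_right x).aestronglyMeasurable

include hp hf hfin in
lemma enorm_avg_sub_le {x : EuclideanSpace ℝ (Fin d)} (hx : 0 < W.δ x ∨ W.R x = 0) (b : ℝ) :
    ‖κ.avg f x - b‖ₑ ≤ (∫⁻ z, κ.Q x z * ‖f z - b‖ₑ) + ind (W.R x ≤ 2 * W.δ x) * ‖b‖ₑ := by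
  set χ := ∫ z in W.O, κ.P x z with hχ
  have hχ0 : 0 ≤ χ := integral_nonneg fun z => κ.nonneg x z
  have hχ1 : χ ≤ 1 := by
    rw [hχ, κ.integral_P_eq]
    exact ENNReal.toReal_le_of_le_ofReal zero_le_one (by simpa using κ.mass_le x)
  have hdec : κ.avg f x - b = (∫ z in W.O, κ.P x z * (f z - b)) + (χ - 1) * b := by
    simp only [mul_sub]
    rw [integral_sub (κ.integrable_mul hp hf hfin x) ((κ.integrable_P x).mul_const b),
      integral_mul_const, avg]
    ring
  rw [hdec]
  refine (enorm_add_le _ _).trans (add_le_add ?_ ?_)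
  · refine (enorm_integral_le_lintegral_enorm _).trans_eq ?_
    rw [lintegral_Q_mul]
    refine lintegral_congr fun z => ?_
    rw [enorm_mul, Real.enorm_eq_ofReal (κ.nonneg x z)]
  · by_cases hR : W.R x ≤ 2 * W.δ x
    · rw [ind_of hR, enorm_mul]
      gcongr
      rw [← ofReal_norm, Real.norm_eq_abs]
      exact ENNReal.ofReal_le_one.2 (abs_le.2 ⟨by linarith, by linarith⟩)
    · push Not at hR
      have h0 : 0 < W.δ x := hx.resolve_right (by linarith [W.δ_nonneg x])
      have : χ = 1 := by rw [hχ, κ.integral_P_eq, κ.mass_eq x h0 hR.le, ENNReal.toReal_one]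
      simp [this]

include hp hf hfin in
/-- Comparison of an average of `f` with a constant. -/
lemma enorm_avg_sub_rpow_le {x : EuclideanSpace ℝ (Fin d)} (hx : 0 < W.δ x ∨ W.R x = 0) (b : ℝ) :
    ‖κ.avg f x - b‖ₑ ^ p ≤ 2 ^ (p - 1) *
      ((∫⁻ z, κ.Q x z * ‖f z - b‖ₑ ^ p) + ind (W.R x ≤ 2 * W.δ x) * ‖b‖ₑ ^ p) := by
  have hp0 : 0 < p := by linarith
  refine (ENNReal.rpow_le_rpow (κ.enorm_avg_sub_le hp hf hfin hx b) hp0.le).trans ?_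
  refine (ENNReal.rpow_add_le_mul_rpow_add_rpow _ _ hp).trans ?_
  gcongr
  · exact κ.lintegral_Q_rpow_le hp hf x b
  · rw [ENNReal.mul_rpow_of_nonneg _ _ hp0.le]
    gcongr
    by_cases hR : W.R x ≤ 2 * W.δ x
    · simp [ind_of hR]
    · simp [ind_of_not hR, hp0]

include hp hf in
lemma enorm_avg_rpow_le (x : EuclideanSpace ℝ (Fin d)) :
    ‖κ.avg f x‖ₑ ^ p ≤ ∫⁻ z, κ.Q x z * ‖f z‖ₑ ^ p := by
  have h := κ.lintegral_Q_rpow_le hp hf x 0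
  simp only [sub_zero] at h
  refine le_trans (ENNReal.rpow_le_rpow ?_ (by linarith)) h
  refine (enorm_integral_le_lintegral_enorm _).trans_eq ?_
  rw [lintegral_Q_mul]
  refine lintegral_congr fun z => ?_
  rw [enorm_mul, Real.enorm_eq_ofReal (κ.nonneg x z)]

/-- The crude averaging kernel at scale `δ x`. -/
noncomputable def U (W : WhitneyData d c) (x z : EuclideanSpace ℝ (Fin d)) : ℝ≥0∞ :=
  ind (z ∈ W.O ∧ dist x z < 8 * W.δ x) * ipow d (W.δ x)

lemma measurable_U : Measurable (Function.uncurry (U W)) := by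
  have h1 := W.continuous_δ
  refine (measurable_ind ?_).mul ((measurable_ipow _).comp (h1.measurable.comp measurable_fst))
  have h2 : MeasurableSet {q : EuclideanSpace ℝ (Fin d) × EuclideanSpace ℝ (Fin d) |
      dist q.1 q.2 < 8 * W.δ q.1} := measurableSet_lt (by fun_prop) (by fun_prop)
  exact (measurable_snd W.measO).inter h2

lemma lintegral_U_le {x : EuclideanSpace ℝ (Fin d)} (h0 : 0 < W.δ x) :
    ∫⁻ z, U W x z ≤ ENNReal.ofReal (8 ^ d * WhitneyData.unitVol d) := by
  have hV := WhitneyData.unitVol_pos (d := d)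
  calc ∫⁻ z, U W x z ≤ ∫⁻ z, ind (z ∈ ball x (8 * W.δ x)) * ipow d (W.δ x) := by
        refine lintegral_mono fun z => ?_
        unfold U
        gcongr
        exact ind_mono fun h => mem_ball'.2 h.2
    _ = volume (ball x (8 * W.δ x)) * ipow d (W.δ x) := by
        rw [lintegral_mul_const' _ _ (ipow_ne_top h0),
          lintegral_ind volume (P := fun z => z ∈ ball x (8 * W.δ x)) measurableSet_ball]
        rfl
    _ ≤ _ := by
        rw [WhitneyData.volume_ball_eq_ofReal x (by positivity), ipow_eq_ofReal h0,
          ← ENNReal.ofReal_mul (by positivity), Real.rpow_neg h0.le, Real.rpow_natCast]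
        refine (ENNReal.ofReal_le_ofReal (le_of_eq ?_))
        rw [mul_pow]
        field_simp

include hp hf in
lemma lintegral_diff_rpow_le {x x' : EuclideanSpace ℝ (Fin d)} (hK : 0 ≤ K)
    (hlt : dist x x' < W.δ x / 2) (b : ℝ) :
    (∫⁻ z in W.O, ‖κ.P x z - κ.P x' z‖ₑ * ‖f z - b‖ₑ) ^ p ≤
      ENNReal.ofReal K ^ p * ENNReal.ofReal (8 ^ d * WhitneyData.unitVol d) ^ (p - 1) *
        ENNReal.ofReal (dist x x' / W.δ x) ^ p * ∫⁻ z, U W x z * ‖f z - b‖ₑ ^ p := by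
  have hp0 : 0 < p := by linarith
  have h0 : 0 < W.δ x := by linarith [dist_nonneg (x := x) (y := x')]
  have hm : Measurable fun z => ‖f z - b‖ₑ := (hf.sub_const b).enorm
  have hU : Measurable (U W x) := measurable_U.of_uncurry_left (x := x)
  have key : ∀ z ∈ W.O, ‖κ.P x z - κ.P x' z‖ₑ ≤
      ENNReal.ofReal K * ENNReal.ofReal (dist x x' / W.δ x) * U W x z := by
    intro z hz
    by_cases hd : dist x z < 8 * W.δ x
    · rw [U, ind_of ⟨hz, hd⟩, one_mul, ipow_eq_ofReal h0, ← ENNReal.ofReal_mul hK,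
        ← ENNReal.ofReal_mul (by positivity), ← ofReal_norm, Real.norm_eq_abs]
      refine ENNReal.ofReal_le_ofReal ((κ.lip x x' z h0 hlt).trans_eq ?_)
      rw [Real.rpow_neg h0.le, Real.rpow_natCast, div_eq_mul_inv]
    · have e1 : κ.P x z = 0 := by
        by_contra hn
        linarith [(κ.support x z hn).2.2]
      have e2 : κ.P x' z = 0 := by
        by_contra hn
        have := (κ.support x' z hn).2.2
        have h3 := abs_le.1 (W.δ_lip x x')
        linarith [dist_triangle x x' z]
      simp [e1, e2]
  calc (∫⁻ z in W.O, ‖κ.P x z - κ.P x' z‖ₑ * ‖f z - b‖ₑ) ^ p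
      ≤ (ENNReal.ofReal K * ENNReal.ofReal (dist x x' / W.δ x) *
          ∫⁻ z, U W x z * ‖f z - b‖ₑ) ^ p := by
        gcongr
        rw [← lintegral_const_mul' _ _ (by finiteness)]
        refine (setLIntegral_mono' W.measO fun z hz => ?_).trans (setLIntegral_le_lintegral W.O _)
        rw [← mul_assoc]
        gcongr
        exact key z hz
    _ = (ENNReal.ofReal K * ENNReal.ofReal (dist x x' / W.δ x)) ^ p *
          (∫⁻ z, U W x z * ‖f z - b‖ₑ) ^ p := ENNReal.mul_rpow_of_nonneg _ _ hp0.le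
    _ ≤ (ENNReal.ofReal K * ENNReal.ofReal (dist x x' / W.δ x)) ^ p *
          (ENNReal.ofReal (8 ^ d * WhitneyData.unitVol d) ^ (p - 1) *
            ∫⁻ z, U W x z * ‖f z - b‖ₑ ^ p) := by
        gcongr
        exact lintegral_mul_rpow_le volume hU hm hp (lintegral_U_le h0)
    _ = _ := by rw [ENNReal.mul_rpow_of_nonneg _ _ hp0.le]; ring

include hp hf hfin in
lemma enorm_avg_sub_avg_le (x x' : EuclideanSpace ℝ (Fin d)) (b : ℝ)
    (hb : b = 0 ∨ (0 < W.δ x ∧ 2 * W.δ x ≤ W.R x ∧ 0 < W.δ x' ∧ 2 * W.δ x' ≤ W.R x')) :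
    ‖κ.avg f x - κ.avg f x'‖ₑ ≤ ∫⁻ z in W.O, ‖κ.P x z - κ.P x' z‖ₑ * ‖f z - b‖ₑ := by
  have hi := κ.integrable_mul hp hf hfin
  have hP := κ.integrable_P
  have hPb : (∫ z in W.O, κ.P x z) * b = (∫ z in W.O, κ.P x' z) * b := by
    rcases hb with rfl | ⟨h1, h2, h3, h4⟩
    · simp
    · rw [κ.integral_P_eq, κ.integral_P_eq, κ.mass_eq x h1 h2, κ.mass_eq x' h3 h4]
  have hi' : ∀ y, Integrable (fun z => κ.P y z * f z - κ.P y z * b) (volume.restrict W.O) :=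
    fun y => (hi y).sub ((hP y).mul_const b)
  have hdec : κ.avg f x - κ.avg f x' = ∫ z in W.O, (κ.P x z - κ.P x' z) * (f z - b) := by
    have e : ∀ z, (κ.P x z - κ.P x' z) * (f z - b) =
      (κ.P x z * f z - κ.P x z * b) - (κ.P x' z * f z - κ.P x' z * b) := fun z => by ring
    simp only [e]
    rw [integral_sub (hi' x) (hi' x'),
      integral_sub (hi x) ((hP x).mul_const b), integral_sub (hi x') ((hP x').mul_const b),
      integral_mul_const, integral_mul_const, hPb, avg, avg]
    ring
  rw [hdec]
  refine (enorm_integral_le_lintegral_enorm _).trans_eq ?_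
  simp only [enorm_mul]

end

end ExtKernel

/-- The tail estimate at scale `r / 8`. -/
lemma exists_lintegral_tail_div_le (d : ℕ) {b : ℝ} (hb : 0 < b) :
    ∃ C : ℝ≥0∞, C ≠ ⊤ ∧ ∀ (x : EuclideanSpace ℝ (Fin d)) (r : ℝ), 0 ≤ r →
      ∫⁻ y, ind (r / 8 ≤ dist x y) * ipow (b + d) (dist x y) ≤ C * ipow b r := by
  obtain ⟨C, hC, h⟩ := exists_lintegral_tail_le d hb
  refine ⟨C * ipow b (1 / 8), ENNReal.mul_ne_top hC (ipow_ne_top (by norm_num)), fun x r hr => ?_⟩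
  refine (h x (r / 8) (by positivity)).trans_eq ?_
  rw [show r / 8 = 1 / 8 * r by ring, ipow_mul (by norm_num), mul_assoc]

section Iterated

variable {α β : Type*} [MeasurableSpace α] [MeasurableSpace β] {μ : Measure α} {ν : Measure β}

lemma lintegral_lintegral_add_right [SFinite ν] (A : α → β → ℝ≥0∞) {B : α → β → ℝ≥0∞}
    (hB : Measurable (Function.uncurry B)) :
    ∫⁻ x, ∫⁻ y, (A x y + B x y) ∂ν ∂μ =
      (∫⁻ x, ∫⁻ y, A x y ∂ν ∂μ) + ∫⁻ x, ∫⁻ y, B x y ∂ν ∂μ := by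
  have h : Measurable fun x => ∫⁻ y, B x y ∂ν := hB.lintegral_prod_right'
  rw [← lintegral_add_right _ h]
  exact lintegral_congr fun x => lintegral_add_right _ (hB.of_uncurry_left (x := x))

lemma lintegral_lintegral_const_mul' {r : ℝ≥0∞} (hr : r ≠ ⊤) (A : α → β → ℝ≥0∞) :
    ∫⁻ x, ∫⁻ y, r * A x y ∂ν ∂μ = r * ∫⁻ x, ∫⁻ y, A x y ∂ν ∂μ := by
  rw [← lintegral_const_mul' _ _ hr]
  exact lintegral_congr fun x => lintegral_const_mul' _ _ hr

end Iterated

namespace WhitneyData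

variable {d : ℕ} {c : ℝ} (W : WhitneyData d c)

/-- The density of the fractional seminorm on `O`. -/
noncomputable def density (a p : ℝ) (f : EuclideanSpace ℝ (Fin d) → ℝ)
    (z y : EuclideanSpace ℝ (Fin d)) : ℝ≥0∞ :=
  ind (z ∈ W.O ∧ y ∈ W.O ∧ dist z y < 1) * (‖f z - f y‖ₑ ^ p * ipow a (dist z y))

/-- The `p`-th power of `|f|`, restricted to `O`. -/
noncomputable def powOn (p : ℝ) (f : EuclideanSpace ℝ (Fin d) → ℝ)
    (z : EuclideanSpace ℝ (Fin d)) : ℝ≥0∞ :=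
  ind (z ∈ W.O) * ‖f z‖ₑ ^ p

/-- The seminorm on `O` together with the weighted norm on `O`. -/
noncomputable def energy (s p : ℝ) (f : EuclideanSpace ℝ (Fin d) → ℝ) : ℝ≥0∞ :=
  (∫⁻ z, ∫⁻ y, W.density (s * p + d) p f z y) + ∫⁻ z, W.powOn p f z * ipow (s * p) (W.R z)

/-- The points outside `O` at which the extension is controlled. -/
def Good (x : EuclideanSpace ℝ (Fin d)) : Prop := x ∉ W.O ∧ (0 < W.δ x ∨ W.R x = 0)

lemma measurable_density (a p : ℝ) {f : EuclideanSpace ℝ (Fin d) → ℝ} (hf : Measurable f) :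
    Measurable (Function.uncurry (W.density a p f)) := by
  have h1 : MeasurableSet {q : EuclideanSpace ℝ (Fin d) × EuclideanSpace ℝ (Fin d) |
      dist q.1 q.2 < 1} := measurableSet_lt (by fun_prop) (by fun_prop)
  have h2 := measurable_ipow a
  refine (measurable_ind ((measurable_fst W.measO).inter
    ((measurable_snd W.measO).inter h1))).mul ?_
  fun_prop

lemma measurable_powOn (p : ℝ) {f : EuclideanSpace ℝ (Fin d) → ℝ} (hf : Measurable f) :
    Measurable (W.powOn p f) :=
  (measurable_ind W.measO).mul (by fun_prop)

lemma powOn_of_mem {p : ℝ} {f : EuclideanSpace ℝ (Fin d) → ℝ} {z : EuclideanSpace ℝ (Fin d)}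
    (hz : z ∈ W.O) : W.powOn p f z = ‖f z‖ₑ ^ p := by
  rw [powOn, ind_of hz, one_mul]

lemma density_of_mem {a p : ℝ} {f : EuclideanSpace ℝ (Fin d) → ℝ}
    {z y : EuclideanSpace ℝ (Fin d)} (hz : z ∈ W.O) (hy : y ∈ W.O) (h : dist z y < 1) :
    W.density a p f z y = ‖f z - f y‖ₑ ^ p * ipow a (dist z y) := by
  rw [density, ind_of ⟨hz, hy, h⟩, one_mul]

end WhitneyData

namespace ExtKernel

variable {d : ℕ} {c K : ℝ} {W : WhitneyData d c} (κ : ExtKernel W K)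

lemma lintegral_lintegral_Q_mul_le {g : EuclideanSpace ℝ (Fin d) → ℝ≥0∞} (hg : Measurable g) :
    ∫⁻ x, ∫⁻ z, κ.Q x z * g z ≤ ENNReal.ofReal K * ∫⁻ z, g z := by
  rw [lintegral_lintegral_swap (κ.measurable_Q.mul (hg.comp measurable_snd)).aemeasurable,
    ← lintegral_const_mul' _ _ (by simp)]
  refine lintegral_mono fun z => ?_
  rw [lintegral_mul_const _ (κ.measurable_Q.of_uncurry_right (y := z))]
  gcongr
  exact κ.lintegral_Q_left_le z

lemma lintegral_Q_mul_density_le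
    {N : EuclideanSpace ℝ (Fin d) → EuclideanSpace ℝ (Fin d) → ℝ≥0∞}
    (hN : Measurable (Function.uncurry N)) :
    ∫⁻ x, ∫⁻ y, ∫⁻ z, κ.Q x z * N z y ≤ ENNReal.ofReal K * ∫⁻ z, ∫⁻ y, N z y := by
  refine le_trans (lintegral_mono fun x => ?_)
    (κ.lintegral_lintegral_Q_mul_le (g := fun z => ∫⁻ y, N z y) hN.lintegral_prod_right')
  have hm : Measurable fun q : EuclideanSpace ℝ (Fin d) × EuclideanSpace ℝ (Fin d) =>
      κ.Q x q.2 * N q.2 q.1 :=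
    ((κ.measurable_Q_right x).comp measurable_snd).mul (hN.comp measurable_swap)
  rw [lintegral_lintegral_swap hm.aemeasurable]
  refine lintegral_mono fun z => ?_
  rw [lintegral_const_mul _ (hN.of_uncurry_left (x := z))]

lemma lintegral_Q_mul_Q_mul_density_le
    {N : EuclideanSpace ℝ (Fin d) → EuclideanSpace ℝ (Fin d) → ℝ≥0∞}
    (hN : Measurable (Function.uncurry N)) :
    ∫⁻ x, ∫⁻ x', ∫⁻ z, κ.Q x z * ∫⁻ z', κ.Q x' z' * N z z' ≤
      ENNReal.ofReal K * (ENNReal.ofReal K * ∫⁻ z, ∫⁻ z', N z z') := by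
  have hm : Measurable fun q : (EuclideanSpace ℝ (Fin d) × EuclideanSpace ℝ (Fin d)) ×
      EuclideanSpace ℝ (Fin d) => κ.Q q.1.2 q.2 * N q.1.1 q.2 :=
    (κ.measurable_Q.comp (measurable_fst.snd.prodMk measurable_snd)).mul
      (hN.comp (measurable_fst.fst.prodMk measurable_snd))
  refine (κ.lintegral_Q_mul_density_le (N := fun z x' => ∫⁻ z', κ.Q x' z' * N z z')
    hm.lintegral_prod_right').trans ?_
  gcongr
  rw [← lintegral_const_mul' _ _ (by simp)]
  exact lintegral_mono fun z => κ.lintegral_lintegral_Q_mul_le (hN.of_uncurry_left (x := z))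

/-- The weighted norm of the averages. -/
lemma lintegral_avg_weight_le {b p : ℝ} (hb : 0 ≤ b) (hp : 1 ≤ p)
    {f : EuclideanSpace ℝ (Fin d) → ℝ} (hf : Measurable f) :
    ∫⁻ x, ‖κ.avg f x‖ₑ ^ p * ipow b (W.R x) ≤
      ENNReal.ofReal K * ipow b 2⁻¹ * ∫⁻ z, W.powOn p f z * ipow b (W.R z) := by
  have hw : Measurable fun z => W.powOn p f z * ipow b (W.R z) :=
    (W.measurable_powOn p hf).mul ((measurable_ipow b).comp W.continuous_R.measurable)
  have hfm : Measurable fun z => ‖f z‖ₑ ^ p := by fun_prop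
  calc ∫⁻ x, ‖κ.avg f x‖ₑ ^ p * ipow b (W.R x)
      ≤ ∫⁻ x, ∫⁻ z, κ.Q x z * (ipow b 2⁻¹ * (W.powOn p f z * ipow b (W.R z))) := by
        refine lintegral_mono fun x => ?_
        refine (mul_le_mul_left (κ.enorm_avg_rpow_le hp hf x) _).trans ?_
        have hm : Measurable fun z => κ.Q x z * ‖f z‖ₑ ^ p := (κ.measurable_Q_right x).mul hfm
        rw [← lintegral_mul_const _ hm]
        refine lintegral_mono fun z => ?_
        by_cases hQ : κ.Q x z = 0
        · simp [hQ]
        obtain ⟨hz, h0, h1, h2⟩ := κ.Q_support hQ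
        have h3 := abs_le.1 (W.R_lip x z)
        rw [W.powOn_of_mem hz, mul_assoc, mul_left_comm (ipow b 2⁻¹)]
        gcongr
        exact ipow_le_of_le_mul hb two_pos (by linarith)
    _ ≤ ENNReal.ofReal K * ∫⁻ z, ipow b 2⁻¹ * (W.powOn p f z * ipow b (W.R z)) :=
        κ.lintegral_lintegral_Q_mul_le (hw.const_mul _)
    _ = _ := by
        rw [lintegral_const_mul' _ _ (ipow_ne_top (by norm_num)), mul_assoc]

/-- The interaction between the averages outside `O` and the values inside `O`. -/
lemma exists_lintegral_cross_le (d : ℕ) (c K : ℝ) {s p : ℝ} (hsp : 0 < s * p) (hp : 1 ≤ p) :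
    ∃ C : ℝ≥0∞, C ≠ ⊤ ∧ ∀ (W : WhitneyData d c) (κ : ExtKernel W K)
      (f : EuclideanSpace ℝ (Fin d) → ℝ), Measurable f → (∫⁻ z in W.O, ‖f z‖ₑ ^ p) < ⊤ →
      ∫⁻ x, ∫⁻ y, ind (W.Good x ∧ y ∈ W.O ∧ dist x y < 1 / 32) *
        (‖κ.avg f x - f y‖ₑ ^ p * ipow (s * p + d) (dist x y)) ≤ C * W.energy s p f := by
  obtain ⟨Ct, hCt, htail⟩ := exists_lintegral_tail_div_le d hsp
  set a := s * p + d with ha_def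
  have ha : 0 ≤ a := by positivity
  have h5 : ipow a 5⁻¹ ≠ ⊤ := ipow_ne_top (by norm_num)
  have h2p : (2 : ℝ≥0∞) ^ (p - 1) ≠ ⊤ := ENNReal.rpow_ne_top_of_nonneg (by linarith) (by simp)
  refine ⟨2 ^ (p - 1) * (ipow a 5⁻¹ * ENNReal.ofReal K + Ct), by finiteness, ?_⟩
  intro W κ f hf hfin
  have hN := W.measurable_density a p hf
  have hw := W.measurable_powOn p hf
  have hR := W.continuous_R
  set A : EuclideanSpace ℝ (Fin d) → EuclideanSpace ℝ (Fin d) → ℝ≥0∞ :=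
    fun x y => ∫⁻ z, κ.Q x z * W.density a p f z y with hA
  set B : EuclideanSpace ℝ (Fin d) → EuclideanSpace ℝ (Fin d) → ℝ≥0∞ :=
    fun x y => ind (W.R y / 8 ≤ dist x y) * ipow a (dist x y) * W.powOn p f y with hB
  have hAm : Measurable (Function.uncurry A) := by
    have hm : Measurable fun q : (EuclideanSpace ℝ (Fin d) × EuclideanSpace ℝ (Fin d)) ×
        EuclideanSpace ℝ (Fin d) => κ.Q q.1.1 q.2 * W.density a p f q.2 q.1.2 :=
      (κ.measurable_Q.comp (measurable_fst.fst.prodMk measurable_snd)).mul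
        (hN.comp (measurable_snd.prodMk measurable_fst.snd))
    exact hm.lintegral_prod_right'
  have hBm : Measurable (Function.uncurry B) := by
    have h1 : MeasurableSet {q : EuclideanSpace ℝ (Fin d) × EuclideanSpace ℝ (Fin d) |
      W.R q.2 / 8 ≤ dist q.1 q.2} := measurableSet_le (by fun_prop) (by fun_prop)
    have h2 := measurable_ipow a
    exact ((measurable_ind h1).mul (by fun_prop)).mul (hw.comp measurable_snd)
  have hpt : ∀ x y, ind (W.Good x ∧ y ∈ W.O ∧ dist x y < 1 / 32) *
      (‖κ.avg f x - f y‖ₑ ^ p * ipow a (dist x y)) ≤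
        2 ^ (p - 1) * (ipow a 5⁻¹ * A x y + B x y) := by
    intro x y
    by_cases hxy : W.Good x ∧ y ∈ W.O ∧ dist x y < 1 / 32
    swap
    · rw [ind_of_not hxy, zero_mul]; exact zero_le
    rw [ind_of hxy, one_mul]
    obtain ⟨⟨hxO, hgood⟩, hy, hlt⟩ := hxy
    have hsep := W.sep x y hxO hy
    have hm : Measurable fun z => κ.Q x z * ‖f z - f y‖ₑ ^ p :=
      (κ.measurable_Q_right x).mul (by fun_prop)
    refine (mul_le_mul_left (κ.enorm_avg_sub_rpow_le hp hf hfin hgood (f y)) _).trans ?_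
    rw [mul_assoc, add_mul]
    refine mul_le_mul_right (add_le_add ?_ ?_) _
    · rw [← lintegral_mul_const _ hm, ← lintegral_const_mul' _ _ h5]
      refine lintegral_mono fun z => ?_
      by_cases hQ : κ.Q x z = 0
      · simp [hQ]
      obtain ⟨hz, h0, h1, h2⟩ := κ.Q_support hQ
      rw [min_eq_left h1.le] at hsep
      have h3 : dist z y ≤ 5 * dist x y := by linarith [dist_triangle_left z y x]
      rw [W.density_of_mem hz hy (by linarith)]
      calc κ.Q x z * ‖f z - f y‖ₑ ^ p * ipow a (dist x y)
          ≤ κ.Q x z * ‖f z - f y‖ₑ ^ p * (ipow a 5⁻¹ * ipow a (dist z y)) := by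
            gcongr
            exact ipow_le_of_le_mul ha (by norm_num) h3
        _ = _ := by ring
    · rw [hB]
      simp only
      rw [W.powOn_of_mem hy, mul_right_comm]
      gcongr
      refine ind_mono fun hle => ?_
      have h3 := abs_le.1 (W.R_lip x y)
      have h4 : W.R x ≤ 2 * dist x y := by
        rcases min_le_iff.1 hsep with h | h <;> linarith [W.R_nonneg x]
      linarith [W.R_nonneg x]
  have hIA : ∫⁻ x, ∫⁻ y, A x y ≤ ENNReal.ofReal K * ∫⁻ z, ∫⁻ y, W.density a p f z y :=
    κ.lintegral_Q_mul_density_le hN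
  have hIB : ∫⁻ x, ∫⁻ y, B x y ≤ Ct * ∫⁻ z, W.powOn p f z * ipow (s * p) (W.R z) := by
    rw [lintegral_lintegral_swap hBm.aemeasurable, ← lintegral_const_mul' _ _ hCt]
    refine lintegral_mono fun y => ?_
    simp only [hB]
    have h1 : Measurable fun x => ind (W.R y / 8 ≤ dist x y) * ipow a (dist x y) :=
      (measurable_ind (measurableSet_le measurable_const (by fun_prop))).mul
        ((measurable_ipow a).comp (by fun_prop))
    rw [lintegral_mul_const _ h1, mul_left_comm, mul_comm _ (W.powOn p f y)]
    gcongr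
    simp only [dist_comm _ y]
    exact htail y _ (W.R_nonneg y)
  calc ∫⁻ x, ∫⁻ y, _ ≤ ∫⁻ x, ∫⁻ y, 2 ^ (p - 1) * (ipow a 5⁻¹ * A x y + B x y) :=
        lintegral_mono fun x => lintegral_mono fun y => hpt x y
    _ = 2 ^ (p - 1) * (ipow a 5⁻¹ * (∫⁻ x, ∫⁻ y, A x y) + ∫⁻ x, ∫⁻ y, B x y) := by
        rw [lintegral_lintegral_const_mul' h2p, lintegral_lintegral_add_right _ hBm,
          lintegral_lintegral_const_mul' h5]
    _ ≤ 2 ^ (p - 1) * (ipow a 5⁻¹ * (ENNReal.ofReal K * W.energy s p f) +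
          Ct * W.energy s p f) := by
        gcongr
        · exact hIA.trans (by gcongr; exact le_self_add)
        · exact hIB.trans (by gcongr; exact le_add_self)
    _ = _ := by ring

end ExtKernel

namespace ExtKernel

variable {d : ℕ} {c K : ℝ} {W : WhitneyData d c} (κ : ExtKernel W K)

/-- The part of the far interaction controlled by the weighted norm. -/
noncomputable def farTail (a p : ℝ) (f : EuclideanSpace ℝ (Fin d) → ℝ)
    (x x' : EuclideanSpace ℝ (Fin d)) : ℝ≥0∞ :=
  ∫⁻ z, κ.Q x z * (W.powOn p f z * (ind (W.R z / 8 ≤ dist x x') * ipow a (dist x x')))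

lemma measurable_farTail (a p : ℝ) {f : EuclideanSpace ℝ (Fin d) → ℝ} (hf : Measurable f) :
    Measurable (Function.uncurry (κ.farTail a p f)) := by
  have hw := W.measurable_powOn p hf
  have hR := W.continuous_R
  have h1 : MeasurableSet {q : (EuclideanSpace ℝ (Fin d) × EuclideanSpace ℝ (Fin d)) ×
      EuclideanSpace ℝ (Fin d) | W.R q.2 / 8 ≤ dist q.1.1 q.1.2} :=
    measurableSet_le (by fun_prop) (by fun_prop)
  have h2 := measurable_ipow a
  have hm : Measurable fun q : (EuclideanSpace ℝ (Fin d) × EuclideanSpace ℝ (Fin d)) ×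
      EuclideanSpace ℝ (Fin d) => κ.Q q.1.1 q.2 * (W.powOn p f q.2 *
        (ind (W.R q.2 / 8 ≤ dist q.1.1 q.1.2) * ipow a (dist q.1.1 q.1.2))) :=
    (κ.measurable_Q.comp (measurable_fst.fst.prodMk measurable_snd)).mul
      ((hw.comp measurable_snd).mul ((measurable_ind h1).mul (by fun_prop)))
  exact hm.lintegral_prod_right'

lemma lintegral_farTail_le {b p : ℝ} {Ct : ℝ≥0∞} (hCt : Ct ≠ ⊤)
    (htail : ∀ (x : EuclideanSpace ℝ (Fin d)) (r : ℝ), 0 ≤ r →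
      ∫⁻ y, ind (r / 8 ≤ dist x y) * ipow (b + d) (dist x y) ≤ Ct * ipow b r)
    {f : EuclideanSpace ℝ (Fin d) → ℝ} (hf : Measurable f) :
    ∫⁻ x, ∫⁻ x', κ.farTail (b + d) p f x x' ≤
      ENNReal.ofReal K * (Ct * ∫⁻ z, W.powOn p f z * ipow b (W.R z)) := by
  have hw := W.measurable_powOn p hf
  have hR := W.continuous_R
  have hg : Measurable fun z => W.powOn p f z * ipow b (W.R z) :=
    hw.mul ((measurable_ipow b).comp hR.measurable)
  rw [← lintegral_const_mul' _ _ hCt]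
  refine le_trans (lintegral_mono fun x => ?_)
    (κ.lintegral_lintegral_Q_mul_le (hg.const_mul Ct))
  have h1 : MeasurableSet {q : EuclideanSpace ℝ (Fin d) × EuclideanSpace ℝ (Fin d) |
      W.R q.2 / 8 ≤ dist x q.1} := measurableSet_le (by fun_prop) (by fun_prop)
  have h2 := measurable_ipow (b + d)
  have hm : Measurable fun q : EuclideanSpace ℝ (Fin d) × EuclideanSpace ℝ (Fin d) =>
      κ.Q x q.2 * (W.powOn p f q.2 *
        (ind (W.R q.2 / 8 ≤ dist x q.1) * ipow (b + d) (dist x q.1))) :=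
    ((κ.measurable_Q_right x).comp measurable_snd).mul
      ((hw.comp measurable_snd).mul ((measurable_ind h1).mul (by fun_prop)))
  unfold farTail
  rw [lintegral_lintegral_swap hm.aemeasurable]
  refine lintegral_mono fun z => ?_
  have hm1 : Measurable fun x' => ind (W.R z / 8 ≤ dist x x') * ipow (b + d) (dist x x') :=
    (measurable_ind (measurableSet_le measurable_const (by fun_prop))).mul (by fun_prop)
  rw [lintegral_const_mul _ (hm1.const_mul _), lintegral_const_mul _ hm1, mul_left_comm Ct]
  gcongr
  exact htail x _ (W.R_nonneg z)

/-- The interaction between averages at points whose distance exceeds the scale. -/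
lemma exists_lintegral_far_le (d : ℕ) (c K : ℝ) {s p : ℝ} (hsp : 0 < s * p) (hp : 1 ≤ p) :
    ∃ C : ℝ≥0∞, C ≠ ⊤ ∧ ∀ (W : WhitneyData d c) (κ : ExtKernel W K)
      (f : EuclideanSpace ℝ (Fin d) → ℝ), Measurable f → (∫⁻ z in W.O, ‖f z‖ₑ ^ p) < ⊤ →
      ∫⁻ x, ∫⁻ x', ind (W.Good x ∧ W.Good x' ∧ dist x x' < 1 / 32 ∧ W.δ x ≤ 2 * dist x x') *
        (‖κ.avg f x - κ.avg f x'‖ₑ ^ p * ipow (s * p + d) (dist x x')) ≤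
          C * W.energy s p f := by
  obtain ⟨Ct, hCt, htail⟩ := exists_lintegral_tail_div_le d hsp
  set a := s * p + d with ha_def
  have ha : 0 ≤ a := by positivity
  have h21 : ipow a 21⁻¹ ≠ ⊤ := ipow_ne_top (by norm_num)
  have h2p : (2 : ℝ≥0∞) ^ (p - 1) ≠ ⊤ := ENNReal.rpow_ne_top_of_nonneg (by linarith) (by simp)
  set c2 : ℝ≥0∞ := 2 ^ (p - 1)
  refine ⟨c2 * c2 * (ipow a 21⁻¹ * (ENNReal.ofReal K * ENNReal.ofReal K)) +
    c2 * c2 * (ENNReal.ofReal K * Ct) + c2 * (ENNReal.ofReal K * Ct), by finiteness, ?_⟩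
  intro W κ f hf hfin
  have hN := W.measurable_density a p hf
  set A : EuclideanSpace ℝ (Fin d) → EuclideanSpace ℝ (Fin d) → ℝ≥0∞ :=
    fun x x' => ∫⁻ z, κ.Q x z * ∫⁻ z', κ.Q x' z' * W.density a p f z z' with hA
  set B := κ.farTail a p f with hB
  have hBm : Measurable (Function.uncurry B) := κ.measurable_farTail a p hf
  have hBm' : Measurable (Function.uncurry fun x x' => B x' x) := hBm.comp measurable_swap
  have hIA : ∫⁻ x, ∫⁻ x', A x x' ≤
      ENNReal.ofReal K * (ENNReal.ofReal K * ∫⁻ z, ∫⁻ y, W.density a p f z y) :=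
    κ.lintegral_Q_mul_Q_mul_density_le hN
  have hIB : ∫⁻ x, ∫⁻ x', B x x' ≤
      ENNReal.ofReal K * (Ct * ∫⁻ z, W.powOn p f z * ipow (s * p) (W.R z)) :=
    κ.lintegral_farTail_le hCt htail hf
  have hIB' : ∫⁻ x, ∫⁻ x', B x' x ≤
      ENNReal.ofReal K * (Ct * ∫⁻ z, W.powOn p f z * ipow (s * p) (W.R z)) := by
    rw [lintegral_lintegral_swap hBm'.aemeasurable]; exact hIB
  have hpt : ∀ x x', ind (W.Good x ∧ W.Good x' ∧ dist x x' < 1 / 32 ∧ W.δ x ≤ 2 * dist x x') *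
      (‖κ.avg f x - κ.avg f x'‖ₑ ^ p * ipow a (dist x x')) ≤
        c2 * c2 * (ipow a 21⁻¹ * A x x') + c2 * c2 * B x x' + c2 * B x' x := by
    intro x x'
    by_cases hxx : W.Good x ∧ W.Good x' ∧ dist x x' < 1 / 32 ∧ W.δ x ≤ 2 * dist x x'
    swap
    · rw [ind_of_not hxx, zero_mul]; exact zero_le
    rw [ind_of hxx, one_mul]
    obtain ⟨⟨-, hg⟩, ⟨-, hg'⟩, hlt, hδ⟩ := hxx
    have hl := abs_le.1 (W.δ_lip x x')
    have hl' := abs_le.1 (W.R_lip x x')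
    have hdf : Measurable fun q : EuclideanSpace ℝ (Fin d) × EuclideanSpace ℝ (Fin d) =>
        κ.Q x' q.2 * ‖f q.2 - f q.1‖ₑ ^ p :=
      ((κ.measurable_Q_right x').comp measurable_snd).mul (by fun_prop)
    have hI1 : Measurable fun z => ∫⁻ z', κ.Q x' z' * ‖f z' - f z‖ₑ ^ p :=
      hdf.lintegral_prod_right'
    have hfm : Measurable fun z => ‖f z‖ₑ ^ p := by fun_prop
    have hm1 : Measurable fun z => κ.Q x z * ∫⁻ z', κ.Q x' z' * ‖f z' - f z‖ₑ ^ p :=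
      (κ.measurable_Q_right x).mul hI1
    have hm2 : Measurable fun z =>
        κ.Q x z * (ind (W.R x' ≤ 2 * W.δ x') * ‖f z‖ₑ ^ p) :=
      (κ.measurable_Q_right x).mul (hfm.const_mul _)
    have hm3 : Measurable fun z => κ.Q x' z * ‖f z‖ₑ ^ p := (κ.measurable_Q_right x').mul hfm
    have hm4 : ∀ z, Measurable fun z' => κ.Q x' z' * ‖f z' - f z‖ₑ ^ p :=
      fun z => (κ.measurable_Q_right x').mul (by fun_prop)
    have step : ‖κ.avg f x - κ.avg f x'‖ₑ ^ p ≤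
        c2 * c2 * (∫⁻ z, κ.Q x z * ∫⁻ z', κ.Q x' z' * ‖f z' - f z‖ₑ ^ p) +
        c2 * c2 * (∫⁻ z, κ.Q x z * (ind (W.R x' ≤ 2 * W.δ x') * ‖f z‖ₑ ^ p)) +
        c2 * (ind (W.R x ≤ 2 * W.δ x) * ∫⁻ z, κ.Q x' z * ‖f z‖ₑ ^ p) := by
      calc ‖κ.avg f x - κ.avg f x'‖ₑ ^ p
          ≤ c2 * ((∫⁻ z, κ.Q x z * ‖f z - κ.avg f x'‖ₑ ^ p) +
              ind (W.R x ≤ 2 * W.δ x) * ‖κ.avg f x'‖ₑ ^ p) :=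
            κ.enorm_avg_sub_rpow_le hp hf hfin hg _
        _ ≤ c2 * ((∫⁻ z, κ.Q x z * (c2 * ((∫⁻ z', κ.Q x' z' * ‖f z' - f z‖ₑ ^ p) +
              ind (W.R x' ≤ 2 * W.δ x') * ‖f z‖ₑ ^ p))) +
              ind (W.R x ≤ 2 * W.δ x) * ∫⁻ z, κ.Q x' z * ‖f z‖ₑ ^ p) := by
            gcongr with z
            · rw [enorm_sub_rev]
              exact κ.enorm_avg_sub_rpow_le hp hf hfin hg' _
            · exact κ.enorm_avg_rpow_le hp hf x'
        _ = _ := by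
            simp only [mul_left_comm _ c2, mul_add]
            rw [lintegral_add_right _ (hm2.const_mul c2), lintegral_const_mul' _ _ h2p,
              lintegral_const_mul' _ _ h2p]
            ring
    refine (mul_le_mul_left step _).trans ?_
    rw [add_mul, add_mul]
    refine add_le_add (add_le_add ?_ ?_) ?_
    · rw [mul_assoc]
      refine mul_le_mul_right ?_ _
      rw [← lintegral_mul_const _ hm1,
        ← lintegral_const_mul' _ _ h21]
      refine lintegral_mono fun z => ?_
      by_cases hQ : κ.Q x z = 0
      · simp [hQ]
      obtain ⟨hz, -, -, h2⟩ := κ.Q_support hQ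
      rw [mul_assoc, mul_left_comm (ipow a 21⁻¹)]
      refine mul_le_mul_right ?_ _
      rw [← lintegral_mul_const _ (hm4 z),
        ← lintegral_const_mul' _ _ h21]
      refine lintegral_mono fun z' => ?_
      by_cases hQ' : κ.Q x' z' = 0
      · simp [hQ']
      obtain ⟨hz', -, -, h2'⟩ := κ.Q_support hQ'
      have h3 : dist z z' ≤ 21 * dist x x' := by
        linarith [dist_triangle4 z x x' z', dist_comm z x]
      rw [W.density_of_mem hz hz' (by linarith), enorm_sub_rev (f z')]
      calc κ.Q x' z' * ‖f z - f z'‖ₑ ^ p * ipow a (dist x x')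
          ≤ κ.Q x' z' * ‖f z - f z'‖ₑ ^ p * (ipow a 21⁻¹ * ipow a (dist z z')) := by
            gcongr
            exact ipow_le_of_le_mul ha (by norm_num) h3
        _ = _ := by ring
    · rw [mul_assoc]
      refine mul_le_mul_right ?_ _
      rw [← lintegral_mul_const _ hm2, hB, farTail]
      refine lintegral_mono fun z => ?_
      by_cases hQ : κ.Q x z = 0
      · simp [hQ]
      obtain ⟨hz, -, -, h2⟩ := κ.Q_support hQ
      have h3 := abs_le.1 (W.R_lip x z)
      rw [W.powOn_of_mem hz, mul_assoc, mul_right_comm, mul_comm (_ * _) (‖f z‖ₑ ^ p)]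
      gcongr
      exact ind_mono fun h => by linarith
    · rw [mul_assoc]
      refine mul_le_mul_right ?_ _
      rw [mul_right_comm, mul_comm, ← lintegral_mul_const _ hm3,
        hB, farTail]
      refine lintegral_mono fun z => ?_
      by_cases hQ : κ.Q x' z = 0
      · simp [hQ]
      obtain ⟨hz, -, -, h2⟩ := κ.Q_support hQ
      have h3 := abs_le.1 (W.R_lip x' z)
      rw [W.powOn_of_mem hz, mul_assoc, dist_comm x' x]
      gcongr
      exact ind_mono fun h => by linarith
  calc ∫⁻ x, ∫⁻ x', _
      ≤ ∫⁻ x, ∫⁻ x', (c2 * c2 * (ipow a 21⁻¹ * A x x') + c2 * c2 * B x x' + c2 * B x' x) :=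
        lintegral_mono fun x => lintegral_mono fun x' => hpt x x'
    _ = c2 * c2 * (ipow a 21⁻¹ * ∫⁻ x, ∫⁻ x', A x x') + c2 * c2 * (∫⁻ x, ∫⁻ x', B x x') +
          c2 * ∫⁻ x, ∫⁻ x', B x' x := by
        rw [lintegral_lintegral_add_right _ (hBm'.const_mul c2),
          lintegral_lintegral_add_right _ (hBm.const_mul (c2 * c2)),
          lintegral_lintegral_const_mul' h2p, lintegral_lintegral_const_mul' (by finiteness),
          lintegral_lintegral_const_mul' h21, lintegral_lintegral_const_mul' (by finiteness)]
    _ ≤ c2 * c2 * (ipow a 21⁻¹ * (ENNReal.ofReal K * (ENNReal.ofReal K * W.energy s p f))) +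
          c2 * c2 * (ENNReal.ofReal K * (Ct * W.energy s p f)) +
          c2 * (ENNReal.ofReal K * (Ct * W.energy s p f)) := by
        refine add_le_add (add_le_add ?_ ?_) ?_
        · refine mul_le_mul_right (mul_le_mul_right (hIA.trans ?_) _) _
          gcongr; exact le_self_add
        · refine mul_le_mul_right (hIB.trans ?_) _
          gcongr; exact le_add_self
        · refine mul_le_mul_right (hIB'.trans ?_) _
          gcongr; exact le_add_self
    _ = _ := by ring

end ExtKernel

namespace ExtKernel

variable {d : ℕ} {c K : ℝ} {W : WhitneyData d c} (κ : ExtKernel W K)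

/-- The oscillation of `f` around its average at `x`. -/
noncomputable def osc (p : ℝ) (f : EuclideanSpace ℝ (Fin d) → ℝ)
    (x : EuclideanSpace ℝ (Fin d)) : ℝ≥0∞ :=
  ∫⁻ z, U W x z * ∫⁻ w, κ.Q x w * ‖f w - f z‖ₑ ^ p

/-- The size of `f` near `x`, if the two scales at `x` are comparable. -/
noncomputable def size (W : WhitneyData d c) (p : ℝ) (f : EuclideanSpace ℝ (Fin d) → ℝ)
    (x : EuclideanSpace ℝ (Fin d)) : ℝ≥0∞ :=
  ind (W.δ x ≤ 4 * W.R x ∧ W.R x < 8 * W.δ x) * ∫⁻ z, U W x z * ‖f z‖ₑ ^ p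

lemma avg_eq_zero {x : EuclideanSpace ℝ (Fin d)} (h : W.R x ≤ W.δ x)
    (f : EuclideanSpace ℝ (Fin d) → ℝ) : κ.avg f x = 0 := by
  have h0 : ∀ z, κ.P x z = 0 := fun z => by
    by_contra hne
    linarith [(κ.support x z hne).2.1]
  simp [avg, h0]

lemma enorm_avg_sub_avg_rpow_le {p : ℝ} (hp : 1 ≤ p) {f : EuclideanSpace ℝ (Fin d) → ℝ}
    (hf : Measurable f) (hfin : (∫⁻ z in W.O, ‖f z‖ₑ ^ p) < ⊤) (hK : 0 ≤ K)
    {x x' : EuclideanSpace ℝ (Fin d)} (hlt : dist x x' < W.δ x / 2) :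
    ‖κ.avg f x - κ.avg f x'‖ₑ ^ p ≤
      ENNReal.ofReal K ^ p * ENNReal.ofReal (8 ^ d * WhitneyData.unitVol d) ^ (p - 1) *
        ENNReal.ofReal (dist x x' / W.δ x) ^ p * (2 ^ (p - 1) * κ.osc p f x + size W p f x) := by
  have h0 : 0 < W.δ x := by linarith [dist_nonneg (x := x) (y := x')]
  have hp0 : 0 < p := by linarith
  have hl := abs_le.1 (W.δ_lip x x')
  have hl' := abs_le.1 (W.R_lip x x')
  have h2p : (2 : ℝ≥0∞) ^ (p - 1) ≠ ⊤ := ENNReal.rpow_ne_top_of_nonneg (by linarith) (by simp)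
  rcases le_or_gt (8 * W.δ x) (W.R x) with hR | hR
  · have h1 := ENNReal.rpow_le_rpow (κ.enorm_avg_sub_avg_le hp hf hfin x x' (κ.avg f x)
      (Or.inr ⟨h0, by linarith, by linarith, by linarith⟩)) hp0.le
    refine (h1.trans (κ.lintegral_diff_rpow_le hp hf hK hlt _)).trans ?_
    gcongr
    refine le_trans ?_ le_self_add
    rw [osc, ← lintegral_const_mul' _ _ h2p]
    refine lintegral_mono fun z => ?_
    rw [mul_left_comm]
    refine mul_le_mul_right ?_ _
    have h2 := κ.enorm_avg_sub_rpow_le hp hf hfin (Or.inl h0) (f z)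
    rw [ind_of_not (by linarith), zero_mul, add_zero, enorm_sub_rev] at h2
    exact h2
  · by_cases hR4 : W.δ x ≤ 4 * W.R x
    · have h1 := ENNReal.rpow_le_rpow (κ.enorm_avg_sub_avg_le hp hf hfin x x' 0
        (Or.inl rfl)) hp0.le
      refine (h1.trans (κ.lintegral_diff_rpow_le hp hf hK hlt _)).trans ?_
      gcongr
      refine le_trans ?_ le_add_self
      rw [size, ind_of ⟨hR4, hR⟩, one_mul]
      simp only [sub_zero, le_refl]
    · push Not at hR4
      rw [κ.avg_eq_zero (by linarith), κ.avg_eq_zero (by linarith), sub_zero, enorm_zero,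
        ENNReal.zero_rpow_of_pos hp0]
      exact zero_le

lemma ipow_mul_osc_le {b p : ℝ} (hb : 0 ≤ b) {f : EuclideanSpace ℝ (Fin d) → ℝ}
    {x : EuclideanSpace ℝ (Fin d)} (h0 : 0 < W.δ x) :
    ipow b (W.δ x) * κ.osc p f x ≤
      ipow (b + d) 12⁻¹ * ∫⁻ z, ∫⁻ w, κ.Q x w * W.density (b + d) p f w z := by
  have h12 : ipow (b + d) 12⁻¹ ≠ ⊤ := ipow_ne_top (by norm_num)
  rw [osc, ← lintegral_const_mul' _ _ (ipow_ne_top h0), ← lintegral_const_mul' _ _ h12]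
  refine lintegral_mono fun z => ?_
  by_cases hz : z ∈ W.O ∧ dist x z < 8 * W.δ x
  swap
  · rw [U, ind_of_not hz]; simp
  rw [U, ind_of hz, one_mul, ← mul_assoc, ← ipow_add h0,
    ← lintegral_const_mul' _ _ (ipow_ne_top h0), ← lintegral_const_mul' _ _ h12]
  refine lintegral_mono fun w => ?_
  by_cases hQ : κ.Q x w = 0
  · simp [hQ]
  obtain ⟨hw, -, h1, h2⟩ := κ.Q_support hQ
  have hd : dist w z ≤ 12 * W.δ x := by
    linarith [dist_triangle w x z, dist_comm w x, hz.2]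
  rw [W.density_of_mem hw hz.1 (by linarith [W.R_le x])]
  calc ipow (b + d) (W.δ x) * (κ.Q x w * ‖f w - f z‖ₑ ^ p)
      ≤ (ipow (b + d) 12⁻¹ * ipow (b + d) (dist w z)) * (κ.Q x w * ‖f w - f z‖ₑ ^ p) := by
        gcongr
        exact ipow_le_of_le_mul (by positivity) (by norm_num) hd
    _ = _ := by ring

lemma ipow_mul_size_le {b p : ℝ} (hb : 0 ≤ b) {f : EuclideanSpace ℝ (Fin d) → ℝ}
    {x : EuclideanSpace ℝ (Fin d)} (h0 : 0 < W.δ x) :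
    ipow b (W.δ x) * size W p f x ≤ ipow (b + d) 9⁻¹ *
      ∫⁻ z, ind (dist x z < 64 * W.R z) * (W.powOn p f z * ipow (b + d) (W.R z)) := by
  have h9 : ipow (b + d) 9⁻¹ ≠ ⊤ := ipow_ne_top (by norm_num)
  rw [size]
  by_cases hx : W.δ x ≤ 4 * W.R x ∧ W.R x < 8 * W.δ x
  swap
  · rw [ind_of_not hx]; simp
  rw [ind_of hx, one_mul, ← lintegral_const_mul' _ _ (ipow_ne_top h0),
    ← lintegral_const_mul' _ _ h9]
  refine lintegral_mono fun z => ?_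
  by_cases hz : z ∈ W.O ∧ dist x z < 8 * W.δ x
  swap
  · rw [U, ind_of_not hz]; simp
  have hl := abs_le.1 (W.R_lip x z)
  rw [U, ind_of hz, one_mul, ← mul_assoc, ← ipow_add h0, ind_of (by linarith), one_mul,
    W.powOn_of_mem hz.1]
  calc ipow (b + d) (W.δ x) * ‖f z‖ₑ ^ p
      ≤ (ipow (b + d) 9⁻¹ * ipow (b + d) (W.R z)) * ‖f z‖ₑ ^ p := by
        gcongr
        exact ipow_le_of_le_mul (by positivity) (by norm_num) (by linarith)
    _ = _ := by ring

lemma measurable_size_majorant (W : WhitneyData d c) (a p : ℝ)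
    {f : EuclideanSpace ℝ (Fin d) → ℝ} (hf : Measurable f) :
    Measurable (Function.uncurry fun x z =>
      ind (dist x z < 64 * W.R z) * (W.powOn p f z * ipow a (W.R z))) := by
  have hw := W.measurable_powOn p hf
  have hR := W.continuous_R
  have h2 := measurable_ipow a
  have h1 : MeasurableSet {q : EuclideanSpace ℝ (Fin d) × EuclideanSpace ℝ (Fin d) |
      dist q.1 q.2 < 64 * W.R q.2} := measurableSet_lt (by fun_prop) (by fun_prop)
  exact (measurable_ind h1).mul ((hw.comp measurable_snd).mul
    (h2.comp (hR.measurable.comp measurable_snd)))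

lemma lintegral_size_majorant_le (W : WhitneyData d c) (b p : ℝ)
    {f : EuclideanSpace ℝ (Fin d) → ℝ} (hf : Measurable f) :
    ∫⁻ x, ∫⁻ z, ind (dist x z < 64 * W.R z) * (W.powOn p f z * ipow (b + d) (W.R z)) ≤
      ENNReal.ofReal (64 ^ d * WhitneyData.unitVol d) *
        ∫⁻ z, W.powOn p f z * ipow b (W.R z) := by
  have hV := WhitneyData.unitVol_pos (d := d)
  rw [lintegral_lintegral_swap (measurable_size_majorant W (b + d) p hf).aemeasurable,
    ← lintegral_const_mul' _ _ ENNReal.ofReal_ne_top]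
  refine lintegral_mono fun z => ?_
  rcases (W.R_nonneg z).eq_or_lt with h0 | h0
  · have : ∀ x, ¬ dist x z < 64 * W.R z := fun x => by
      rw [← h0, mul_zero]; exact not_lt.2 dist_nonneg
    simp [ind_of_not (this _)]
  · have hm : MeasurableSet {x | dist x z < 64 * W.R z} := measurableSet_ball (x := z)
    rw [lintegral_mul_const _ (measurable_ind hm), lintegral_ind _ hm,
      show {x | dist x z < 64 * W.R z} = ball z (64 * W.R z) from rfl,
      WhitneyData.volume_ball_eq_ofReal z (by positivity), ipow_add h0,
      ipow_natCast h0, ENNReal.ofReal_pow h0.le]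
    have h1 : ENNReal.ofReal ((64 * W.R z) ^ d * WhitneyData.unitVol d) =
        ENNReal.ofReal (64 ^ d * WhitneyData.unitVol d) * ENNReal.ofReal (W.R z) ^ d := by
      rw [← ENNReal.ofReal_pow h0.le, ← ENNReal.ofReal_mul (by positivity)]
      congr 1; ring
    have h2 : ENNReal.ofReal (W.R z) ^ d * (ENNReal.ofReal (W.R z) ^ d)⁻¹ = 1 :=
      ENNReal.mul_inv_cancel (by simpa using fun h : W.R z ≤ 0 => absurd h0 (not_lt.2 h)) (by simp)
    rw [h1]
    refine le_of_eq ?_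
    calc _ = ENNReal.ofReal (64 ^ d * WhitneyData.unitVol d) * (W.powOn p f z * ipow b (W.R z)) *
          (ENNReal.ofReal (W.R z) ^ d * (ENNReal.ofReal (W.R z) ^ d)⁻¹) := by ring
      _ = _ := by rw [h2, mul_one]

/-- The interaction between averages at points whose distance is less than the scale. -/
lemma exists_lintegral_near_scale_le (d : ℕ) (hd : 1 ≤ d) (c : ℝ) {s p K : ℝ} (hK : 0 ≤ K)
    (hs0 : 0 < s) (hs1 : s < 1) (hp : 1 ≤ p) :
    ∃ C : ℝ≥0∞, C ≠ ⊤ ∧ ∀ (W : WhitneyData d c) (κ : ExtKernel W K)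
      (f : EuclideanSpace ℝ (Fin d) → ℝ), Measurable f → (∫⁻ z in W.O, ‖f z‖ₑ ^ p) < ⊤ →
      ∫⁻ x, ∫⁻ x', ind (dist x x' < W.δ x / 2) *
        (‖κ.avg f x - κ.avg f x'‖ₑ ^ p * ipow (s * p + d) (dist x x')) ≤
          C * W.energy s p f := by
  have hsp : s * p < p := by nlinarith
  have hb : 0 ≤ s * p := by positivity
  obtain ⟨Cn, hCn, hnear⟩ := exists_lintegral_near_le d hd hsp
  set a := s * p + d with ha_def
  have h12 : ipow a 12⁻¹ ≠ ⊤ := ipow_ne_top (by norm_num)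
  have h9 : ipow a 9⁻¹ ≠ ⊤ := ipow_ne_top (by norm_num)
  have h2p : (2 : ℝ≥0∞) ^ (p - 1) ≠ ⊤ := ENNReal.rpow_ne_top_of_nonneg (by linarith) (by simp)
  set c2 : ℝ≥0∞ := 2 ^ (p - 1)
  set K2 : ℝ≥0∞ := ENNReal.ofReal K ^ p *
    ENNReal.ofReal (8 ^ d * WhitneyData.unitVol d) ^ (p - 1) with hK2
  have hK2t : K2 ≠ ⊤ := ENNReal.mul_ne_top (ENNReal.rpow_ne_top_of_nonneg (by linarith) ENNReal.ofReal_ne_top)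
    (ENNReal.rpow_ne_top_of_nonneg (by linarith) ENNReal.ofReal_ne_top)
  refine ⟨K2 * Cn * c2 * ipow a 12⁻¹ * ENNReal.ofReal K +
    K2 * Cn * ipow a 9⁻¹ * ENNReal.ofReal (64 ^ d * WhitneyData.unitVol d), by finiteness, ?_⟩
  intro W κ f hf hfin
  have hN := W.measurable_density a p hf
  set A : EuclideanSpace ℝ (Fin d) → ℝ≥0∞ :=
    fun x => ∫⁻ z, ∫⁻ w, κ.Q x w * W.density a p f w z with hA
  set B : EuclideanSpace ℝ (Fin d) → ℝ≥0∞ := fun x =>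
    ∫⁻ z, ind (dist x z < 64 * W.R z) * (W.powOn p f z * ipow a (W.R z)) with hB
  have hBm : Measurable B := (measurable_size_majorant W a p hf).lintegral_prod_right'
  have hpt : ∀ x, ∫⁻ x', ind (dist x x' < W.δ x / 2) *
      (‖κ.avg f x - κ.avg f x'‖ₑ ^ p * ipow a (dist x x')) ≤
        K2 * Cn * c2 * ipow a 12⁻¹ * A x + K2 * Cn * ipow a 9⁻¹ * B x := by
    intro x
    rcases (W.δ_nonneg x).eq_or_lt with h0 | h0
    · have : ∀ x', ¬ dist x x' < W.δ x / 2 := fun x' => by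
        rw [← h0, zero_div]; exact not_lt.2 dist_nonneg
      simp [ind_of_not (this _)]
    set M := c2 * κ.osc p f x + size W p f x with hM
    have hδm : Measurable fun x' => ind (dist x x' < W.δ x) *
        ENNReal.ofReal (dist x x' / W.δ x) ^ p * ipow a (dist x x') := by
      have h2 := measurable_ipow a
      exact ((measurable_ind (measurableSet_lt (by fun_prop) measurable_const)).mul
        (by fun_prop)).mul (by fun_prop)
    calc ∫⁻ x', ind (dist x x' < W.δ x / 2) *
          (‖κ.avg f x - κ.avg f x'‖ₑ ^ p * ipow a (dist x x'))
        ≤ ∫⁻ x', (K2 * M) * (ind (dist x x' < W.δ x) *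
            ENNReal.ofReal (dist x x' / W.δ x) ^ p * ipow a (dist x x')) := by
          refine lintegral_mono fun x' => ?_
          by_cases hlt : dist x x' < W.δ x / 2
          swap
          · rw [ind_of_not hlt, zero_mul]; exact zero_le
          rw [ind_of hlt, one_mul, ind_of (by linarith), one_mul]
          refine (mul_le_mul_left (κ.enorm_avg_sub_avg_rpow_le hp hf hfin hK hlt) _).trans ?_
          exact le_of_eq (by ring)
      _ = (K2 * M) * ∫⁻ x', ind (dist x x' < W.δ x) *
            ENNReal.ofReal (dist x x' / W.δ x) ^ p * ipow a (dist x x') :=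
          lintegral_const_mul _ hδm
      _ ≤ (K2 * M) * (Cn * ipow (s * p) (W.δ x)) := mul_le_mul_right (hnear x _ h0) _
      _ = K2 * Cn * c2 * (ipow (s * p) (W.δ x) * κ.osc p f x) +
            K2 * Cn * (ipow (s * p) (W.δ x) * size W p f x) := by rw [hM]; ring
      _ ≤ K2 * Cn * c2 * (ipow a 12⁻¹ * A x) + K2 * Cn * (ipow a 9⁻¹ * B x) :=
          add_le_add (mul_le_mul_right (κ.ipow_mul_osc_le hb h0) _)
            (mul_le_mul_right (ipow_mul_size_le hb h0) _)
      _ = _ := by ring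
  have hIA : ∫⁻ x, A x ≤ ENNReal.ofReal K * W.energy s p f := by
    refine (κ.lintegral_Q_mul_density_le hN).trans ?_
    gcongr; exact le_self_add
  have hIB : ∫⁻ x, B x ≤
      ENNReal.ofReal (64 ^ d * WhitneyData.unitVol d) * W.energy s p f := by
    refine (lintegral_size_majorant_le W (s * p) p hf).trans ?_
    gcongr; exact le_add_self
  calc ∫⁻ x, ∫⁻ x', _
      ≤ ∫⁻ x, (K2 * Cn * c2 * ipow a 12⁻¹ * A x + K2 * Cn * ipow a 9⁻¹ * B x) :=
        lintegral_mono hpt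
    _ = K2 * Cn * c2 * ipow a 12⁻¹ * (∫⁻ x, A x) + K2 * Cn * ipow a 9⁻¹ * ∫⁻ x, B x := by
        rw [lintegral_add_right _ (hBm.const_mul _), lintegral_const_mul' _ _ (by finiteness),
          lintegral_const_mul' _ _ (by finiteness)]
    _ ≤ _ := add_le_add (mul_le_mul_right hIA _) (mul_le_mul_right hIB _)
    _ = _ := by ring

end ExtKernel

namespace ExtKernel

variable {d : ℕ} {c K : ℝ} {W : WhitneyData d c} (κ : ExtKernel W K)

open Classical in
/-- The extension of `f` from `O` by averages. -/
noncomputable def ext (f : EuclideanSpace ℝ (Fin d) → ℝ) : EuclideanSpace ℝ (Fin d) → ℝ :=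
  W.O.piecewise f (κ.avg f)

lemma ext_of_mem {f : EuclideanSpace ℝ (Fin d) → ℝ} {x : EuclideanSpace ℝ (Fin d)}
    (hx : x ∈ W.O) : κ.ext f x = f x := by
  classical exact Set.piecewise_eq_of_mem _ _ _ hx

lemma ext_of_notMem {f : EuclideanSpace ℝ (Fin d) → ℝ} {x : EuclideanSpace ℝ (Fin d)}
    (hx : x ∉ W.O) : κ.ext f x = κ.avg f x := by
  classical exact Set.piecewise_eq_of_notMem _ _ _ hx

lemma measurable_ext {f : EuclideanSpace ℝ (Fin d) → ℝ} (hf : Measurable f) :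
    Measurable (κ.ext f) := by
  classical exact hf.piecewise W.measO (κ.measurable_avg hf)

/-- The difference quotient of `u` and `v` on a set of pairs. -/
lemma measurable_quotient {a p : ℝ} {u v : EuclideanSpace ℝ (Fin d) → ℝ} (hu : Measurable u)
    (hv : Measurable v) {S : EuclideanSpace ℝ (Fin d) → EuclideanSpace ℝ (Fin d) → Prop}
    (hS : MeasurableSet {q : EuclideanSpace ℝ (Fin d) × EuclideanSpace ℝ (Fin d) | S q.1 q.2}) :
    Measurable (Function.uncurry fun x y =>
      ind (S x y) * (‖u x - v y‖ₑ ^ p * ipow a (dist x y))) := by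
  have h2 := measurable_ipow a
  exact (measurable_ind hS).mul (by fun_prop)

lemma exists_lintegral_outside_le (d : ℕ) (hd : 1 ≤ d) (c : ℝ) {s p K : ℝ} (hK : 0 ≤ K)
    (hs0 : 0 < s) (hs1 : s < 1) (hp : 1 ≤ p) :
    ∃ C : ℝ≥0∞, C ≠ ⊤ ∧ ∀ (W : WhitneyData d c) (κ : ExtKernel W K)
      (f : EuclideanSpace ℝ (Fin d) → ℝ), Measurable f → (∫⁻ z in W.O, ‖f z‖ₑ ^ p) < ⊤ →
      ∫⁻ x, ∫⁻ x', ind (W.Good x ∧ W.Good x' ∧ dist x x' < 1 / 32) *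
        (‖κ.avg f x - κ.avg f x'‖ₑ ^ p * ipow (s * p + d) (dist x x')) ≤
          C * W.energy s p f := by
  obtain ⟨C₁, hC₁, h₁⟩ := exists_lintegral_far_le d c K (show 0 < s * p by positivity) hp
  obtain ⟨C₂, hC₂, h₂⟩ := exists_lintegral_near_scale_le d hd c hK hs0 hs1 hp
  refine ⟨C₁ + C₂, by finiteness, fun W κ f hf hfin => ?_⟩
  have hδ := W.continuous_δ
  have hm : Measurable (Function.uncurry fun x x' => ind (dist x x' < W.δ x / 2) *
      (‖κ.avg f x - κ.avg f x'‖ₑ ^ p * ipow (s * p + d) (dist x x'))) :=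
    measurable_quotient (κ.measurable_avg hf) (κ.measurable_avg hf)
      (S := fun x x' => dist x x' < W.δ x / 2) (measurableSet_lt (by fun_prop) (by fun_prop))
  rw [add_mul]
  refine le_trans ?_ (add_le_add (h₁ W κ f hf hfin) (h₂ W κ f hf hfin))
  rw [← lintegral_lintegral_add_right _ hm]
  refine lintegral_mono fun x => lintegral_mono fun x' => ?_
  by_cases hx : W.Good x ∧ W.Good x' ∧ dist x x' < 1 / 32
  swap
  · rw [ind_of_not hx, zero_mul]; exact zero_le
  rw [ind_of hx]
  rcases le_or_gt (W.δ x) (2 * dist x x') with h | h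
  · rw [ind_of ⟨hx.1, hx.2.1, hx.2.2, h⟩]; exact le_self_add
  · rw [ind_of (show dist x x' < W.δ x / 2 by linarith)]; exact le_add_self

/-- The extension has controlled fractional seminorm at small distances. -/
lemma exists_lintegral_ext_near_le (d : ℕ) (hd : 1 ≤ d) (c : ℝ) {s p K : ℝ} (hK : 0 ≤ K)
    (hs0 : 0 < s) (hs1 : s < 1) (hp : 1 ≤ p) :
    ∃ C : ℝ≥0∞, C ≠ ⊤ ∧ ∀ (W : WhitneyData d c) (κ : ExtKernel W K)
      (f : EuclideanSpace ℝ (Fin d) → ℝ), Measurable f → (∫⁻ z in W.O, ‖f z‖ₑ ^ p) < ⊤ →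
      ∫⁻ x, ∫⁻ y, ind (dist x y < 1 / 32) *
        (‖κ.ext f x - κ.ext f y‖ₑ ^ p * ipow (s * p + d) (dist x y)) ≤
          C * W.energy s p f := by
  obtain ⟨C₁, hC₁, h₁⟩ := exists_lintegral_outside_le d hd c hK hs0 hs1 hp
  obtain ⟨C₂, hC₂, h₂⟩ := exists_lintegral_cross_le d c K (show 0 < s * p by positivity) hp
  refine ⟨C₁ + C₂ + C₂ + 1, by finiteness, fun W κ f hf hfin => ?_⟩
  have hδ := W.continuous_δ
  have hR := W.continuous_R
  set a := s * p + d
  have hG : MeasurableSet {x | W.Good x} :=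
    W.measO.compl.inter ((measurableSet_lt measurable_const hδ.measurable).union
      (measurableSet_eq_fun hR.measurable measurable_const))
  have h32 : MeasurableSet {q : EuclideanSpace ℝ (Fin d) × EuclideanSpace ℝ (Fin d) |
      dist q.1 q.2 < 1 / 32} := measurableSet_lt (by fun_prop) (by fun_prop)
  set X : EuclideanSpace ℝ (Fin d) → EuclideanSpace ℝ (Fin d) → ℝ≥0∞ := fun x y =>
    ind (W.Good x ∧ y ∈ W.O ∧ dist x y < 1 / 32) *
      (‖κ.avg f x - f y‖ₑ ^ p * ipow a (dist x y)) with hX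
  have hXm : Measurable (Function.uncurry X) :=
    measurable_quotient (κ.measurable_avg hf) hf
      (S := fun x y => W.Good x ∧ y ∈ W.O ∧ dist x y < 1 / 32)
      ((measurable_fst hG).inter ((measurable_snd W.measO).inter h32))
  have hXm' : Measurable (Function.uncurry fun x y => X y x) := hXm.comp measurable_swap
  have hN := W.measurable_density a p hf
  have hI : ∫⁻ x, ∫⁻ y, X x y ≤ C₂ * W.energy s p f := h₂ W κ f hf hfin
  have hI' : ∫⁻ x, ∫⁻ y, X y x ≤ C₂ * W.energy s p f := by
    rw [lintegral_lintegral_swap hXm'.aemeasurable]; exact hI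
  have hD : ∫⁻ x, ∫⁻ y, W.density a p f x y ≤ 1 * W.energy s p f := by
    rw [one_mul]; exact le_self_add
  rw [add_mul, add_mul, add_mul]
  refine le_trans ?_ (add_le_add (add_le_add (add_le_add (h₁ W κ f hf hfin) hI) hI') hD)
  rw [← lintegral_lintegral_add_right _ hXm, ← lintegral_lintegral_add_right _ hXm',
    ← lintegral_lintegral_add_right _ hN]
  refine lintegral_mono_ae (W.good.mono fun x hx => lintegral_mono_ae (W.good.mono fun y hy => ?_))
  by_cases hlt : dist x y < 1 / 32
  swap
  · rw [ind_of_not hlt, zero_mul]; exact zero_le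
  rw [ind_of hlt, one_mul]
  by_cases hxO : x ∈ W.O <;> by_cases hyO : y ∈ W.O
  · rw [κ.ext_of_mem hxO, κ.ext_of_mem hyO, W.density_of_mem hxO hyO (by linarith)]
    exact le_add_self
  · refine le_trans ?_ le_self_add
    refine le_trans ?_ le_add_self
    rw [κ.ext_of_mem hxO, κ.ext_of_notMem hyO, hX, dist_comm x y, enorm_sub_rev]
    simp only
    rw [ind_of ⟨⟨hyO, hy hyO⟩, hxO, dist_comm x y ▸ hlt⟩, one_mul]
  · refine le_trans ?_ le_self_add
    refine le_trans ?_ le_self_add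
    refine le_trans ?_ le_add_self
    rw [κ.ext_of_notMem hxO, κ.ext_of_mem hyO, hX]
    simp only
    rw [ind_of ⟨⟨hxO, hx hxO⟩, hyO, hlt⟩, one_mul]
  · refine le_trans ?_ le_self_add
    refine le_trans ?_ le_self_add
    refine le_trans ?_ le_self_add
    rw [κ.ext_of_notMem hxO, κ.ext_of_notMem hyO, ind_of ⟨⟨hxO, hx hxO⟩, ⟨hyO, hy hyO⟩, hlt⟩,
      one_mul]

lemma one_le_ipow {b r : ℝ} (hb : 0 ≤ b) (hr : r ≤ 1) : 1 ≤ ipow b r := by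
  have h := ipow_anti hb hr
  rwa [ipow, ENNReal.ofReal_one, ENNReal.one_rpow] at h

/-- The weighted norm of the extension. -/
lemma lintegral_ext_weight_le {s p : ℝ} (hs : 0 ≤ s) (hp : 1 ≤ p)
    {f : EuclideanSpace ℝ (Fin d) → ℝ} (hf : Measurable f) :
    ∫⁻ x, ‖κ.ext f x‖ₑ ^ p * ipow (s * p) (W.R x) ≤
      (ENNReal.ofReal K * ipow (s * p) 2⁻¹ + 1) * W.energy s p f := by
  have hw : Measurable fun z => W.powOn p f z * ipow (s * p) (W.R z) :=
    (W.measurable_powOn p hf).mul ((measurable_ipow _).comp W.continuous_R.measurable)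
  have hE : ∫⁻ z, W.powOn p f z * ipow (s * p) (W.R z) ≤ W.energy s p f := le_add_self
  rw [add_mul, one_mul]
  refine le_trans ?_ (add_le_add ((κ.lintegral_avg_weight_le (show 0 ≤ s * p by positivity)
    hp hf).trans (mul_le_mul_right hE _)) hE)
  rw [← lintegral_add_right _ hw]
  refine lintegral_mono fun x => ?_
  by_cases hx : x ∈ W.O
  · rw [κ.ext_of_mem hx, W.powOn_of_mem hx]; exact le_add_self
  · rw [κ.ext_of_notMem hx]; exact le_self_add

end ExtKernel

/-- The part of the fractional seminorm at distances between `1 / 32` and `1` is controlled by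
the `L^p` norm. -/
lemma lintegral_quotient_le {d : ℕ} {a p : ℝ} (ha : 0 ≤ a) (hp : 1 ≤ p)
    {u : EuclideanSpace ℝ (Fin d) → ℝ} (hu : Measurable u) :
    ∫⁻ x, ∫⁻ y, ind (dist x y < 1) * (‖u x - u y‖ₑ ^ p * ipow a (dist x y)) ≤
      (∫⁻ x, ∫⁻ y, ind (dist x y < 1 / 32) * (‖u x - u y‖ₑ ^ p * ipow a (dist x y))) +
      2 ^ (p - 1) * ipow a (1 / 32) * (2 * ENNReal.ofReal (WhitneyData.unitVol d)) *
        ∫⁻ x, ‖u x‖ₑ ^ p := by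
  have h2p : (2 : ℝ≥0∞) ^ (p - 1) ≠ ⊤ := ENNReal.rpow_ne_top_of_nonneg (by linarith) (by simp)
  have hi : ipow a (1 / 32) ≠ ⊤ := ipow_ne_top (by norm_num)
  set c2 : ℝ≥0∞ := 2 ^ (p - 1)
  obtain ⟨A, hA⟩ : ∃ A : EuclideanSpace ℝ (Fin d) → EuclideanSpace ℝ (Fin d) → ℝ≥0∞,
    A = fun x y => ind (dist x y < 1) * ‖u x‖ₑ ^ p := ⟨_, rfl⟩
  have hB : MeasurableSet {q : EuclideanSpace ℝ (Fin d) × EuclideanSpace ℝ (Fin d) |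
      dist q.1 q.2 < 1} := measurableSet_lt (by fun_prop) (by fun_prop)
  have hAm : Measurable (Function.uncurry A) := by
    rw [hA]
    exact (measurable_ind hB).mul (by fun_prop)
  have hAm' : Measurable (Function.uncurry fun x y => A y x) := hAm.comp measurable_swap
  have hIA : ∫⁻ x, ∫⁻ y, A x y =
      ENNReal.ofReal (WhitneyData.unitVol d) * ∫⁻ x, ‖u x‖ₑ ^ p := by
    rw [← lintegral_const_mul' _ _ ENNReal.ofReal_ne_top]
    refine lintegral_congr fun x => ?_
    have hm : MeasurableSet {y | dist x y < 1} := by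
      simp only [dist_comm x]; exact measurableSet_ball (x := x)
    rw [hA, lintegral_mul_const _ (measurable_ind hm), lintegral_ind _ hm]
    congr 1
    simp only [dist_comm x]
    rw [show {y | dist y x < 1} = ball x 1 from rfl,
      WhitneyData.volume_ball_eq_ofReal x one_pos, one_pow, one_mul]
  have hIA' : ∫⁻ x, ∫⁻ y, A y x =
      ENNReal.ofReal (WhitneyData.unitVol d) * ∫⁻ x, ‖u x‖ₑ ^ p := by
    rw [lintegral_lintegral_swap hAm'.aemeasurable]; exact hIA
  have hS : Measurable (Function.uncurry fun x y => c2 * ipow a (1 / 32) * (A x y + A y x)) :=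
    Measurable.const_mul (f := fun q : EuclideanSpace ℝ (Fin d) × EuclideanSpace ℝ (Fin d) =>
      A q.1 q.2 + A q.2 q.1) (Measurable.add hAm hAm') _
  have hlast : 2 ^ (p - 1) * ipow a (1 / 32) * (2 * ENNReal.ofReal (WhitneyData.unitVol d)) *
        ∫⁻ x, ‖u x‖ₑ ^ p = ∫⁻ x, ∫⁻ y, c2 * ipow a (1 / 32) * (A x y + A y x) := by
    rw [lintegral_lintegral_const_mul' (by finiteness), lintegral_lintegral_add_right _ hAm', hIA,
      hIA']
    ring
  rw [hlast, ← lintegral_lintegral_add_right _ hS]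
  refine lintegral_mono fun x => lintegral_mono fun y => ?_
  by_cases h1 : dist x y < 1
  swap
  · rw [ind_of_not h1, zero_mul]; exact zero_le
  by_cases h32 : dist x y < 1 / 32
  · rw [ind_of h1, ind_of h32]; exact le_self_add
  refine le_trans ?_ le_add_self
  simp only [hA]
  rw [dist_comm y x, ind_of h1, one_mul, one_mul, one_mul, mul_right_comm]
  refine mul_le_mul' ?_ (ipow_anti ha (not_lt.1 h32))
  refine (ENNReal.rpow_le_rpow enorm_sub_le (by linarith)).trans ?_
  exact ENNReal.rpow_add_le_mul_rpow_add_rpow _ _ hp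

/-- The extension operator is bounded. -/
lemma ExtKernel.exists_ext_le (d : ℕ) (hd : 1 ≤ d) (c : ℝ) {s p K : ℝ} (hK : 0 ≤ K)
    (hs0 : 0 < s) (hs1 : s < 1) (hp : 1 ≤ p) :
    ∃ C : ℝ≥0∞, C ≠ ⊤ ∧ ∀ (W : WhitneyData d c) (κ : ExtKernel W K)
      (f : EuclideanSpace ℝ (Fin d) → ℝ), Measurable f → (∫⁻ z in W.O, ‖f z‖ₑ ^ p) < ⊤ →
      (∫⁻ x, ‖κ.ext f x‖ₑ ^ p) +
        (∫⁻ x, ∫⁻ y, ind (dist x y < 1) *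
          (‖κ.ext f x - κ.ext f y‖ₑ ^ p * ipow (s * p + d) (dist x y))) +
        (∫⁻ x, ‖κ.ext f x‖ₑ ^ p * ipow (s * p) (W.R x)) ≤ C * W.energy s p f := by
  obtain ⟨C₁, hC₁, h₁⟩ := exists_lintegral_ext_near_le d hd c hK hs0 hs1 hp
  have h2p : (2 : ℝ≥0∞) ^ (p - 1) ≠ ⊤ := ENNReal.rpow_ne_top_of_nonneg (by linarith) (by simp)
  have hi : ipow (s * p + d) (1 / 32) ≠ ⊤ := ipow_ne_top (by norm_num)
  have hi2 : ipow (s * p) 2⁻¹ ≠ ⊤ := ipow_ne_top (by norm_num)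
  set L : ℝ≥0∞ := ENNReal.ofReal K * ipow (s * p) 2⁻¹ + 1
  set T : ℝ≥0∞ := 2 ^ (p - 1) * ipow (s * p + d) (1 / 32) *
    (2 * ENNReal.ofReal (WhitneyData.unitVol d))
  have hL : L ≠ ⊤ := by finiteness
  have hT : T ≠ ⊤ := by finiteness
  refine ⟨L + (C₁ + T * L) + L, by finiteness, fun W κ f hf hfin => ?_⟩
  have hw := κ.lintegral_ext_weight_le hs0.le hp hf
  have hl : ∫⁻ x, ‖κ.ext f x‖ₑ ^ p ≤ L * W.energy s p f := by
    refine le_trans (lintegral_mono fun x => ?_) hw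
    exact le_mul_of_one_le_right' (one_le_ipow (by positivity) (by linarith [W.R_le x]))
  have hg := (lintegral_quotient_le (show 0 ≤ s * p + d by positivity) hp
    (κ.measurable_ext hf)).trans (add_le_add (h₁ W κ f hf hfin) (mul_le_mul_right hl _))
  refine (add_le_add (add_le_add hl hg) hw).trans_eq ?_
  ring

lemma WhitneyData.kernelConst_nonneg (d : ℕ) {c : ℝ} (hc : 0 < c) :
    0 ≤ WhitneyData.kernelConst d c :=
  (div_pos four_pos (WhitneyData.massConst_pos hc)).le.trans (WhitneyData.le_kernelConst hc)

section Geometry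

variable {d : ℕ} {c : ℝ} {O D : Set (EuclideanSpace ℝ (Fin d))}

/-- The part of the boundary on which `O` is thick is a null set. -/
lemma volume_thick_eq_zero (hc : 0 < c) (hO : IsOpen O)
    {N : Set (EuclideanSpace ℝ (Fin d))} (hN : N ⊆ frontier O)
    (hthick : ∀ x ∈ N, ∀ r : ℝ, 0 < r → r ≤ 1 →
      ENNReal.ofReal c * volume (ball x r) ≤ volume (ball x r ∩ O)) :
    ∀ᵐ x, x ∉ N := by
  filter_upwards [Besicovitch.ae_tendsto_measure_inter_div_of_measurableSet volume
    hO.measurableSet] with x hx hxN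
  have hxO : x ∉ O := fun h =>
    Set.disjoint_left.1 (disjoint_frontier_iff_isOpen.2 hO) (hN hxN) h
  rw [Set.indicator_of_notMem hxO] at hx
  have hle : ENNReal.ofReal c ≤ 0 := by
    refine ge_of_tendsto hx ?_
    filter_upwards [Ioo_mem_nhdsGT (zero_lt_one' ℝ)] with r hr
    have hb : volume (closedBall x r) = volume (ball x r) := by
      rw [Measure.addHaar_closedBall _ _ hr.1.le, Measure.addHaar_ball_of_pos _ _ hr.1]
    have h0 : volume (ball x r) ≠ 0 := (measure_ball_pos _ _ hr.1).ne'
    rw [hb, ENNReal.le_div_iff_mul_le (Or.inl h0) (Or.inl measure_ball_lt_top.ne)]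
    refine (hthick x hxN r hr.1 hr.2.le).trans (measure_mono fun y hy => ?_)
    exact ⟨hy.2, ball_subset_closedBall hy.1⟩
  simp [hc.not_ge] at hle

lemma exists_mem_frontier_dist_le (hO : IsOpen O) {x y : EuclideanSpace ℝ (Fin d)} (hx : x ∉ O)
    (hy : y ∈ O) : ∃ q ∈ frontier O, dist x q ≤ dist x y := by
  have hsub : segment ℝ x y ⊆ closedBall x (dist x y) :=
    (convex_closedBall x (dist x y)).segment_subset (mem_closedBall_self dist_nonneg)
      (mem_closedBall'.2 le_rfl)
  by_contra! hfar
  have hF : ∀ q ∈ segment ℝ x y, q ∈ closure O → q ∈ O := fun q hq hqc => by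
    by_contra hqO
    have hqF : q ∈ frontier O := by rw [hO.frontier_eq]; exact ⟨hqc, hqO⟩
    exact (hfar q hqF).not_ge (mem_closedBall'.1 (hsub hq))
  obtain ⟨q, -, hqO, hqc⟩ := (convex_segment x y).isPreconnected O (closure O)ᶜ hO
    isClosed_closure.isOpen_compl
    (fun q hq => (Classical.em (q ∈ closure O)).imp (hF q hq) id)
    ⟨y, right_mem_segment ℝ x y, hy⟩
    ⟨x, left_mem_segment ℝ x y, fun h => hx (hF x (left_mem_segment ℝ x y) h)⟩
  exact hqc (subset_closure hqO)

open Classical in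
/-- The distance to the thick part of the boundary, or `1` if that part is empty. -/
noncomputable def thickDist (N : Set (EuclideanSpace ℝ (Fin d))) (x : EuclideanSpace ℝ (Fin d)) :
    ℝ :=
  if N.Nonempty then infDist x N else 1

/-- The distance to `D`, truncated and rescaled. -/
noncomputable def truncDist (D : Set (EuclideanSpace ℝ (Fin d))) (x : EuclideanSpace ℝ (Fin d)) :
    ℝ :=
  1 / 64 * min 1 (infDist x D)

lemma abs_infDist_sub_le (S : Set (EuclideanSpace ℝ (Fin d))) (x y : EuclideanSpace ℝ (Fin d)) :
    |infDist x S - infDist y S| ≤ dist x y := by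
  simpa [Real.dist_eq] using (lipschitz_infDist_pt S).dist_le_mul x y

/-- The geometric data of an open set with thick boundary away from `D`. -/
noncomputable def whitneyData (hc : 0 < c) (hO : IsOpen O)
    (hthick : ∀ x ∈ frontier O \ D, ∀ r : ℝ, 0 < r → r ≤ 1 →
      ENNReal.ofReal c * volume (ball x r) ≤ volume (ball x r ∩ O)) : WhitneyData d c where
  O := O
  δ := thickDist (frontier O \ D)
  R := truncDist D
  measO := hO.measurableSet
  δ_nonneg x := by
    unfold thickDist
    split_ifs
    exacts [infDist_nonneg, zero_le_one]
  δ_lip x y := by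
    unfold thickDist
    split_ifs
    exacts [abs_infDist_sub_le _ x y, by simp]
  R_nonneg x := mul_nonneg (by norm_num) (le_min zero_le_one infDist_nonneg)
  R_le x := mul_le_of_le_one_right (by norm_num) (min_le_left _ _)
  R_lip x y := by
    unfold truncDist
    rw [← mul_sub, abs_mul, abs_of_pos (by norm_num : (0 : ℝ) < 1 / 64)]
    gcongr
    refine (abs_min_sub_min_le_max _ _ _ _).trans ?_
    simpa using abs_infDist_sub_le D x y
  thick x h0 hlt := by
    have hle : thickDist (frontier O \ D) x < 1 / 64 :=
      hlt.trans_le (mul_le_of_le_one_right (by norm_num) (min_le_left _ _))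
    have hN : (frontier O \ D).Nonempty := by
      by_contra hN
      rw [thickDist, if_neg hN] at hle
      norm_num at hle
    have h2 : infDist x (frontier O \ D) < 2 * thickDist (frontier O \ D) x := by
      have : thickDist (frontier O \ D) x = infDist x (frontier O \ D) := if_pos hN
      linarith
    obtain ⟨x₀, hx₀, hd⟩ := (infDist_lt_iff hN).1 h2
    exact ⟨x₀, hd, hthick x₀ hx₀ _ h0 (by linarith)⟩
  good := by
    filter_upwards [volume_thick_eq_zero hc hO Set.sdiff_subset hthick] with x hx hxO
    by_contra! h
    obtain ⟨h1, h2⟩ := h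
    have hN : (frontier O \ D).Nonempty := by
      by_contra hN
      rw [thickDist, if_neg hN] at h1
      norm_num at h1
    rw [thickDist, if_pos hN] at h1
    have hcl := (mem_closure_iff_infDist_zero hN).2 (le_antisymm h1 infDist_nonneg)
    refine hx ⟨isClosed_frontier.closure_subset_iff.2 Set.sdiff_subset hcl, fun hxD => h2 ?_⟩
    rw [truncDist, infDist_zero_of_mem hxD]
    simp
  sep x y hx hy := by
    obtain ⟨q, hq, hxq⟩ := exists_mem_frontier_dist_le hO hx hy
    refine le_trans ?_ hxq
    by_cases hqD : q ∈ D
    · refine (min_le_right _ _).trans ?_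
      have h1 := infDist_le_dist_of_mem (x := x) hqD
      have h2 := min_le_right 1 (infDist x D)
      have h3 : 0 ≤ infDist x D := infDist_nonneg
      unfold truncDist
      linarith
    · have hqN : q ∈ frontier O \ D := ⟨hq, hqD⟩
      refine (min_le_left _ _).trans ?_
      rw [thickDist, if_pos ⟨q, hqN⟩]
      exact infDist_le_dist_of_mem hqN

end Geometry

section Norms

variable {d : ℕ} {s p : ℝ}

lemma ofReal_abs_rpow (hp : 0 ≤ p) (u : ℝ) : ENNReal.ofReal (|u| ^ p) = ‖u‖ₑ ^ p := by
  rw [Real.enorm_eq_ofReal_abs, ENNReal.ofReal_rpow_of_nonneg (abs_nonneg u) hp]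

lemma ofReal_quotient (hp : 0 < p) (a : ℝ) (f : EuclideanSpace ℝ (Fin d) → ℝ)
    (x y : EuclideanSpace ℝ (Fin d)) :
    ENNReal.ofReal (|f x - f y| ^ p / dist x y ^ a) =
      ‖f x - f y‖ₑ ^ p * ipow a (dist x y) := by
  rcases eq_or_ne x y with rfl | hxy
  · simp [Real.zero_rpow hp.ne', ENNReal.zero_rpow_of_pos hp]
  · have h0 : 0 < dist x y := dist_pos.2 hxy
    rw [ipow_eq_ofReal h0, ← ofReal_abs_rpow hp.le, ← ENNReal.ofReal_mul (by positivity),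
      Real.rpow_neg h0.le, div_eq_mul_inv]

lemma lpPow_eq (hp : 0 ≤ p) (O : Set (EuclideanSpace ℝ (Fin d)))
    (f : EuclideanSpace ℝ (Fin d) → ℝ) : lpPow d p O f = ∫⁻ x in O, ‖f x‖ₑ ^ p :=
  lintegral_congr fun x => ofReal_abs_rpow hp (f x)

lemma hardyPow_eq (hp : 0 ≤ p) (O D : Set (EuclideanSpace ℝ (Fin d)))
    (f : EuclideanSpace ℝ (Fin d) → ℝ) :
    hardyPow d s p O D f = ∫⁻ x in O, ‖f x‖ₑ ^ p * ipow (s * p) (infDist x D) :=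
  lintegral_congr fun x => by rw [ofReal_abs_rpow hp, ipow]

lemma gagliardoPow_eq (hp : 0 < p) {O : Set (EuclideanSpace ℝ (Fin d))} (hO : MeasurableSet O)
    (f : EuclideanSpace ℝ (Fin d) → ℝ) :
    gagliardoPow d s p O f = ∫⁻ x, ∫⁻ y, ind (x ∈ O ∧ y ∈ O ∧ dist x y < 1) *
      (‖f x - f y‖ₑ ^ p * ipow (s * p + d) (dist x y)) := by
  have hm : ∀ x : EuclideanSpace ℝ (Fin d), MeasurableSet (O ∩ {y | dist x y < 1}) := fun x =>
    hO.inter (measurableSet_lt (by fun_prop) measurable_const)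
  rw [gagliardoPow, setLIntegral_eq_lintegral_ind_mul hO]
  refine lintegral_congr fun x => ?_
  rw [setLIntegral_eq_lintegral_ind_mul (hm x)]
  by_cases hx : x ∈ O
  · rw [ind_of hx, one_mul]
    refine lintegral_congr fun y => ?_
    rw [ofReal_quotient hp]
    simp only [hx, true_and, Set.mem_inter_iff, Set.mem_ofPred_eq]
  · simp [hx, ind_of_not (not_false)]

lemma WhitneyData.energy_le {c : ℝ} (W : WhitneyData d c) {D : Set (EuclideanSpace ℝ (Fin d))}
    (hR : W.R = truncDist D) (hp : 0 < p) {f : EuclideanSpace ℝ (Fin d) → ℝ} (hf : Measurable f) :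
    W.energy s p f ≤ (1 + ipow (s * p) (1 / 64)) * sobPow d s p W.O D f := by
  have hg : ∫⁻ x, ∫⁻ y, W.density (s * p + d) p f x y = gagliardoPow d s p W.O f :=
    (gagliardoPow_eq hp W.measO f).symm
  have hw : ∫⁻ z, W.powOn p f z * ipow (s * p) (W.R z) ≤
      ipow (s * p) (1 / 64) * (lpPow d p W.O f + hardyPow d s p W.O D f) := by
    rw [lpPow_eq hp.le, hardyPow_eq hp.le, ← lintegral_add_left (by fun_prop),
      ← lintegral_const_mul' _ _ (ipow_ne_top (by norm_num)),
      setLIntegral_eq_lintegral_ind_mul W.measO]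
    refine lintegral_mono fun z => ?_
    have h1 : ipow (s * p) (min 1 (infDist z D)) ≤ 1 + ipow (s * p) (infDist z D) := by
      rcases min_cases 1 (infDist z D) with h | h
      · rw [h.1]
        refine le_trans (le_of_eq ?_) le_self_add
        simp [ipow]
      · rw [h.1]
        exact le_add_self
    rw [hR, truncDist, ipow_mul (by norm_num), powOn, mul_assoc]
    refine mul_le_mul_right ?_ _
    calc ‖f z‖ₑ ^ p * (ipow (s * p) (1 / 64) * ipow (s * p) (min 1 (infDist z D)))
        ≤ ‖f z‖ₑ ^ p * (ipow (s * p) (1 / 64) * (1 + ipow (s * p) (infDist z D))) := by gcongr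
      _ = _ := by ring
  rw [energy, hg]
  calc gagliardoPow d s p W.O f + ∫⁻ z, W.powOn p f z * ipow (s * p) (W.R z)
      ≤ sobPow d s p W.O D f + ipow (s * p) (1 / 64) * sobPow d s p W.O D f := by
        refine add_le_add ?_ (hw.trans (mul_le_mul_right ?_ _))
        · exact le_add_self.trans le_self_add
        · unfold sobPow
          gcongr
          exact le_self_add
    _ = _ := by ring

lemma sobPow_univ_le {R : EuclideanSpace ℝ (Fin d) → ℝ} {D : Set (EuclideanSpace ℝ (Fin d))}
    (hR : R = truncDist D) (hs : 0 ≤ s) (hp : 0 < p) (u : EuclideanSpace ℝ (Fin d) → ℝ) :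
    sobPow d s p Set.univ D u ≤ (∫⁻ x, ‖u x‖ₑ ^ p) +
      (∫⁻ x, ∫⁻ y, ind (dist x y < 1) * (‖u x - u y‖ₑ ^ p * ipow (s * p + d) (dist x y))) +
      ∫⁻ x, ‖u x‖ₑ ^ p * ipow (s * p) (R x) := by
  rw [sobPow, lpPow_eq hp.le, hardyPow_eq hp.le, gagliardoPow_eq hp MeasurableSet.univ]
  simp only [Measure.restrict_univ, Set.mem_univ, true_and]
  gcongr with x
  refine ipow_anti (by positivity) ?_
  have h2 := min_le_right 1 (infDist x D)
  have h3 : 0 ≤ infDist x D := infDist_nonneg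
  rw [hR, truncDist]
  linarith

end Norms

/-- For `p ≥ 1`, the extension in Statement 0 can be chosen to be a
linear map on (a.e.-equivalence classes of) functions in `W^{s,p}_D(O)`: it respects
a.e. equality on `O`, addition and scalar multiplication up to a.e. equality, and is
bounded with a constant `C = C(d,s,p,c)`. -/
theorem linear_extension_for_WspD (d : ℕ) (hd : 1 ≤ d) (s p c : ℝ)
    (hs0 : 0 < s) (hs1 : s < 1) (hp : 1 ≤ p) (hc : 0 < c) :
    ∃ C : ℝ, 0 < C ∧
      ∀ O D : Set (EuclideanSpace ℝ (Fin d)), IsOpen O → D ⊆ frontier O →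
        (∀ x ∈ frontier O \ D, ∀ r : ℝ, 0 < r → r ≤ 1 →
          ENNReal.ofReal c * volume (Metric.ball x r) ≤ volume (Metric.ball x r ∩ O)) →
        ∃ Ext : (EuclideanSpace ℝ (Fin d) → ℝ) → (EuclideanSpace ℝ (Fin d) → ℝ),
          (∀ f : EuclideanSpace ℝ (Fin d) → ℝ, Measurable f → sobPow d s p O D f < ⊤ →
            Measurable (Ext f) ∧
            (∀ᵐ x ∂(volume.restrict O), Ext f x = f x) ∧
            sobPow d s p Set.univ D (Ext f) ≤ ENNReal.ofReal C * sobPow d s p O D f) ∧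
          -- well-definedness on a.e.-equivalence classes
          (∀ f g : EuclideanSpace ℝ (Fin d) → ℝ, Measurable f → Measurable g →
            sobPow d s p O D f < ⊤ → sobPow d s p O D g < ⊤ →
            f =ᵐ[volume.restrict O] g → Ext f =ᵐ[volume] Ext g) ∧
          -- additivity
          (∀ f g : EuclideanSpace ℝ (Fin d) → ℝ, Measurable f → Measurable g →
            sobPow d s p O D f < ⊤ → sobPow d s p O D g < ⊤ →
            Ext (f + g) =ᵐ[volume] Ext f + Ext g) ∧
          -- homogeneity
          (∀ (a : ℝ) (f : EuclideanSpace ℝ (Fin d) → ℝ), Measurable f →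
            sobPow d s p O D f < ⊤ →
            Ext (a • f) =ᵐ[volume] a • Ext f) := by
  have hp0 : 0 < p := by linarith
  obtain ⟨C, hC, hbound⟩ :=
    ExtKernel.exists_ext_le d hd c (WhitneyData.kernelConst_nonneg d hc) hs0 hs1 hp
  have h64 : ipow (s * p) (1 / 64) ≠ ⊤ := ipow_ne_top (by norm_num)
  set T : ℝ≥0∞ := C * (1 + ipow (s * p) (1 / 64))
  have hT : T ≠ ⊤ := by finiteness
  refine ⟨T.toReal + 1, by positivity, fun O D hO _ hthick => ?_⟩
  set W : WhitneyData d c := whitneyData hc hO hthick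
  set κ : ExtKernel W (WhitneyData.kernelConst d c) := W.extKernel hc
  have hfin : ∀ f, sobPow d s p O D f < ⊤ → (∫⁻ z in W.O, ‖f z‖ₑ ^ p) < ⊤ := fun f hf =>
    lt_of_le_of_lt ((lpPow_eq hp0.le O f).symm.le.trans (le_self_add.trans le_self_add)) hf
  refine ⟨κ.ext, fun f hf hfs => ⟨κ.measurable_ext hf, ?_, ?_⟩, fun f g _ _ _ _ hfg => ?_,
    fun f g hf hg hfs hgs => ?_, fun a f _ _ => ?_⟩
  · exact (ae_restrict_iff' hO.measurableSet).2 (Filter.Eventually.of_forall fun x hx =>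
      κ.ext_of_mem hx)
  · calc sobPow d s p Set.univ D (κ.ext f)
        ≤ C * W.energy s p f :=
          (sobPow_univ_le (R := W.R) rfl hs0.le hp0 _).trans (hbound W κ f hf (hfin f hfs))
      _ ≤ C * ((1 + ipow (s * p) (1 / 64)) * sobPow d s p O D f) :=
          mul_le_mul_right (W.energy_le rfl hp0 hf) _
      _ = T * sobPow d s p O D f := (mul_assoc _ _ _).symm
      _ ≤ _ := by
          gcongr
          exact ENNReal.le_ofReal_iff_toReal_le hT (by positivity) |>.2 (by linarith)
  · have havg : κ.avg f = κ.avg g := funext fun x =>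
      integral_congr_ae (hfg.mono fun z hz => by simp only [hz])
    filter_upwards [(ae_restrict_iff' hO.measurableSet).1 hfg] with x hx
    by_cases hxO : x ∈ O
    · rw [κ.ext_of_mem hxO, κ.ext_of_mem hxO, hx hxO]
    · rw [κ.ext_of_notMem hxO, κ.ext_of_notMem hxO, havg]
  · refine Filter.Eventually.of_forall fun x => ?_
    by_cases hxO : x ∈ O
    · simp only [Pi.add_apply, κ.ext_of_mem hxO]
    · simp only [Pi.add_apply, κ.ext_of_notMem hxO, ExtKernel.avg, mul_add]
      exact integral_add (κ.integrable_mul hp hf (hfin f hfs) x)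
        (κ.integrable_mul hp hg (hfin g hgs) x)
  · refine Filter.Eventually.of_forall fun x => ?_
    by_cases hxO : x ∈ O
    · simp only [Pi.smul_apply, κ.ext_of_mem hxO]
    · simp only [Pi.smul_apply, κ.ext_of_notMem hxO, ExtKernel.avg, smul_eq_mul]
      rw [← integral_const_mul]
      exact integral_congr_ae (Filter.Eventually.of_forall fun z => by ring)
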